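/- arXiv:1511.04937 — 2 statements merged into one kernel-verified Lean document; each statement's English description precedes it below -/
import Mathlib

section
/- Let b ≥ 2, n ≥ 1, let σ be a permutation of {0,…,b−1} with σ∘τ = τ∘σ, and let Σ ∈ {σ,σ̄}^n. Then (2b^n·L2(R_{b,n}^{Σ,sym}))^2 = 2n·Φ_b^{σ,(2)} + 13/9 + 1/b^n + (2/b^{2n})·∑_{j=1}^n ∑_{λ=1}^{b^n} ∑_{N=1}^{b^n} φ_{b,ε_j(λ,N,Σ)}^σ(N/b^j)·φ_{b,ε_j(λ,N,Σ*)}^{σ̄}(N/b^j). -/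
open Finset
open scoped Classical

noncomputable section

namespace SymHamm

/-- The reversal permutation `τ(k) = b−1−k` on `{0,…,b−1}`. -/
def tauP (b : ℕ) : Equiv.Perm (Fin b) := Fin.revPerm

/-- `σ̄ = τ ∘ σ`. -/
def pbar {b : ℕ} (σ : Equiv.Perm (Fin b)) : Equiv.Perm (Fin b) := σ.trans (tauP b)

/-- Value of a permutation of `Fin b` on a natural number. -/
def permVal {b : ℕ} (σ : Equiv.Perm (Fin b)) (k : ℕ) : ℕ :=
  if h : k < b then (σ ⟨k, h⟩ : ℕ) else 0

/-- Faure's function `φ_{b,h}^σ`, extended with period 1 to all of `ℝ`.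
For `x ∈ [(k−1)/b, k/b)` (i.e. `k−1 = ⌊b·{x}⌋`), it equals
`A([0,h/b);k;Z_b^σ) − h·x` if `h ≤ σ(k−1)` and `(b−h)·x − A([h/b,1);k;Z_b^σ)` otherwise,
where `A` counts the first `k` entries `σ(0)/b,…,σ(k−1)/b` of `Z_b^σ` in the interval. -/
def phi {b : ℕ} (σ : Equiv.Perm (Fin b)) (h : ℕ) (x : ℝ) : ℝ :=
  if h ≤ permVal σ (⌊(b : ℝ) * Int.fract x⌋).toNat then
    (((Finset.range ((⌊(b : ℝ) * Int.fract x⌋).toNat + 1)).filter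
        (fun l => permVal σ l < h)).card : ℝ) - (h : ℝ) * Int.fract x
  else
    ((b : ℝ) - (h : ℝ)) * Int.fract x -
      (((Finset.range ((⌊(b : ℝ) * Int.fract x⌋).toNat + 1)).filter
        (fun l => h ≤ permVal σ l)).card : ℝ)

/-- `φ_b^σ = ∑_{h=0}^{b−1} φ_{b,h}^σ`. -/
def phiS {b : ℕ} (σ : Equiv.Perm (Fin b)) (x : ℝ) : ℝ := ∑ h ∈ range b, phi σ h x

/-- `φ_b^{σ,(2)} = ∑_{h=0}^{b−1} (φ_{b,h}^σ)²`. -/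
def phiS2 {b : ℕ} (σ : Equiv.Perm (Fin b)) (x : ℝ) : ℝ := ∑ h ∈ range b, (phi σ h x) ^ 2

/-- `φ̃_b^σ = ∑_{h=0}^{b−1} φ_{b,h}^σ · φ_{b,h}^{σ̄}`. -/
def phiT {b : ℕ} (σ : Equiv.Perm (Fin b)) (x : ℝ) : ℝ :=
  ∑ h ∈ range b, phi σ h x * phi (pbar σ) h x

/-- `φ̃_{b,1}^σ = ∑_{h=0}^{b−2} φ_{b,h+1}^σ · φ_{b,h}^{σ̄}`. -/
def phiT1 {b : ℕ} (σ : Equiv.Perm (Fin b)) (x : ℝ) : ℝ :=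
  ∑ h ∈ range (b - 1), phi σ (h + 1) x * phi (pbar σ) h x

/-- `φ̃_{b,2}^σ = ∑_{h=0}^{b−2} φ_{b,h}^σ · φ_{b,h+1}^{σ̄}`. -/
def phiT2 {b : ℕ} (σ : Equiv.Perm (Fin b)) (x : ℝ) : ℝ :=
  ∑ h ∈ range (b - 1), phi σ h x * phi (pbar σ) (h + 1) x

/-- `Φ_b^σ = (1/b)·∫_0^1 φ_b^σ`. -/
def PhiS {b : ℕ} (σ : Equiv.Perm (Fin b)) : ℝ := (1 / (b : ℝ)) * ∫ x in (0:ℝ)..1, phiS σ x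

/-- `Φ_b^{σ,(2)} = (1/b)·∫_0^1 φ_b^{σ,(2)}`. -/
def PhiS2 {b : ℕ} (σ : Equiv.Perm (Fin b)) : ℝ := (1 / (b : ℝ)) * ∫ x in (0:ℝ)..1, phiS2 σ x

/-- `Φ̃_b^σ = (1/b)·∫_0^1 φ̃_b^σ`. -/
def PhiT {b : ℕ} (σ : Equiv.Perm (Fin b)) : ℝ := (1 / (b : ℝ)) * ∫ x in (0:ℝ)..1, phiT σ x

/-- `Φ̃_{b,1}^σ = (1/b)·∫_0^1 φ̃_{b,1}^σ`. -/
def PhiT1 {b : ℕ} (σ : Equiv.Perm (Fin b)) : ℝ := (1 / (b : ℝ)) * ∫ x in (0:ℝ)..1, phiT1 σ x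

/-- `Φ̃_{b,2}^σ = (1/b)·∫_0^1 φ̃_{b,2}^σ`. -/
def PhiT2 {b : ℕ} (σ : Equiv.Perm (Fin b)) : ℝ := (1 / (b : ℝ)) * ∫ x in (0:ℝ)..1, phiT2 σ x

/-- `ν_j(N,Σ) = σ_j(N_j)·b^{n−j−1} + … + σ_{n−1}(N_{n−1})`, where `N_i` is the `i`-th
`b`-adic digit of `N`. -/
def nu (b n : ℕ) (S : Fin n → Equiv.Perm (Fin b)) (N j : ℕ) : ℕ :=
  ∑ i : Fin n,
    if j ≤ (i : ℕ) then permVal (S i) ((N / b ^ (i : ℕ)) % b) * b ^ (n - 1 - (i : ℕ)) else 0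

/-- `ε_j(λ,N,Σ)`, for `1 ≤ j ≤ n`: it is `0` when `λ = bⁿ` or `N = bⁿ`; it is the last digit
`λ_n = λ % b` when `j = n`; otherwise, with `Λ_{j−1} = λ % b^{n−j+1}` and `ν_j = ν_j(N,Σ)`,
it is `0` if `Λ_{j−1} ≤ ν_j`, it is `h` if `ν_j + (h−1)b^{n−j} < Λ_{j−1} ≤ ν_j + h·b^{n−j}`
for some `1 ≤ h < b`, and `0` if `ν_j + (b−1)b^{n−j} < Λ_{j−1} < b^{n−j+1}`. -/
def eps (b n : ℕ) (S : Fin n → Equiv.Perm (Fin b)) (lam N j : ℕ) : ℕ :=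
  if lam = b ^ n ∨ N = b ^ n then 0
  else if j = n then lam % b
  else if lam % b ^ (n - j + 1) ≤ nu b n S N j then 0
  else ((lam % b ^ (n - j + 1) - nu b n S N j - 1) / b ^ (n - j) + 1) % b

/-- The point of the digit-scrambled Hammersley point set `R_{b,n}^Σ` with digits `a`:
`(∑_{j=0}^{n−1} σ_j(a_j)/b^{n−j}, ∑_{j=0}^{n−1} a_j/b^{j+1})`. -/
def hammPt (b n : ℕ) (S : Fin n → Equiv.Perm (Fin b)) (a : Fin n → Fin b) : ℝ × ℝ :=
  (∑ j : Fin n, ((S j (a j) : ℕ) : ℝ) / (b : ℝ) ^ (n - (j : ℕ)),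
   ∑ j : Fin n, ((a j : ℕ) : ℝ) / (b : ℝ) ^ ((j : ℕ) + 1))

/-- The symmetrized Hammersley point set `R_{b,n}^{Σ,sym} = R_{b,n}^Σ ∪ R_{b,n}^{Σ*}`,
a family of `2·bⁿ` points. -/
def symFam (b n : ℕ) (S : Fin n → Equiv.Perm (Fin b)) :
    Bool × (Fin n → Fin b) → ℝ × ℝ :=
  fun p => if p.1 then hammPt b n S p.2 else hammPt b n (fun i => pbar (S i)) p.2

/-- Local discrepancy `E(x,y,P) = #{i : P i ∈ [0,x)×[0,y)} − N·x·y` of a finite family of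
points, where `N` is the number of points. -/
def localDisc {ι : Type} [Fintype ι] (P : ι → ℝ × ℝ) (x y : ℝ) : ℝ :=
  ((Finset.univ.filter
      (fun i => 0 ≤ (P i).1 ∧ (P i).1 < x ∧ 0 ≤ (P i).2 ∧ (P i).2 < y)).card : ℝ)
    - (Fintype.card ι : ℝ) * x * y

/-- `L_2` discrepancy `L2(P) = (1/N)·(∫_0^1∫_0^1 E(x,y,P)² dx dy)^{1/2}`. -/
def L2disc {ι : Type} [Fintype ι] (P : ι → ℝ × ℝ) : ℝ :=
  (1 / (Fintype.card ι : ℝ)) *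
    Real.sqrt (∫ x in (0:ℝ)..1, ∫ y in (0:ℝ)..1, (localDisc P x y) ^ 2)

section PeriodicSums

lemma sum_range_mul_eq {α : Type*} [AddCommMonoid α] (a c : ℕ) (f : ℕ → α) :
    ∑ k ∈ range (a * c), f k = ∑ q ∈ range a, ∑ r ∈ range c, f (q * c + r) := by
  induction a with
  | zero => simp
  | succ a ih => rw [Nat.succ_mul, sum_range_add, ih, sum_range_succ]

lemma sum_range_shift_one {α : Type*} [AddCommMonoid α] (M : ℕ) (f : ℕ → α) (h : f M = f 0) :
    ∑ k ∈ range M, f (k + 1) = ∑ k ∈ range M, f k := by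
  cases M with
  | zero => simp
  | succ M => rw [sum_range_succ, h, sum_range_succ']

lemma sum_range_shift {α : Type*} [AddCommMonoid α] (M : ℕ) (f : ℕ → α)
    (h : ∀ k, f (k + M) = f k) (t : ℕ) :
    ∑ k ∈ range M, f (k + t) = ∑ k ∈ range M, f k := by
  induction t with
  | zero => simp
  | succ t ih =>
    rw [← ih, ← sum_range_shift_one M (fun k => f (k + t))]
    · exact sum_congr rfl fun k _ => by rw [add_right_comm, add_assoc]
    · rw [add_comm M t, h, zero_add]

/-- A periodic function is orthogonal to every function whose averages over the
finer progressions of that period vanish. -/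
lemma sum_mul_eq_zero_of_averages (M p b : ℕ) (hb : 0 < b) (f g : ℕ → ℝ)
    (hf : ∀ k, f (k + p) = f k) (hfM : ∀ k, f (k + M) = f k) (hgM : ∀ k, g (k + M) = g k)
    (hg : ∀ k, ∑ t ∈ range b, g (k + t * p) = 0) :
    ∑ k ∈ range M, f k * g k = 0 := by
  have hft : ∀ t k, f (k + t * p) = f k := by
    intro t k
    induction t with
    | zero => simp
    | succ t ih => rw [Nat.succ_mul, ← add_assoc, hf, ih]
  have h1 : ∀ t, ∑ k ∈ range M, f k * g (k + t * p) = ∑ k ∈ range M, f k * g k := by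
    intro t
    rw [← sum_range_shift M (fun k => f k * g k) (fun k => by rw [hfM, hgM]) (t * p)]
    exact sum_congr rfl fun k _ => by rw [hft]
  have h2 : ∑ t ∈ range b, ∑ k ∈ range M, f k * g (k + t * p) = 0 := by
    rw [sum_comm]
    refine sum_eq_zero fun k _ => ?_
    rw [← mul_sum, hg, mul_zero]
  simp only [h1, sum_const, card_range, nsmul_eq_mul] at h2
  have : (b : ℝ) ≠ 0 := by positivity
  exact (mul_eq_zero.mp h2).resolve_left this

lemma sum_range_add_mod {α : Type*} [AddCommMonoid α] (b c : ℕ) (g : ℕ → α) :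
    ∑ t ∈ range b, g ((c + t) % b) = ∑ h ∈ range b, g h := by
  have := sum_range_shift b (fun k => g (k % b)) (fun k => by simp) c
  simp only [add_comm _ c] at this
  rw [this]
  exact sum_congr rfl fun k hk => by rw [Nat.mod_eq_of_lt (mem_range.mp hk)]

lemma digit_add_pow {b i : ℕ} (hb : 0 < b) (k w : ℕ) {e : ℕ} (he : i < e) :
    (k + b ^ e + w) / b ^ i % b = (k + w) / b ^ i % b := by
  obtain ⟨d, rfl⟩ := Nat.exists_eq_add_of_lt he
  have : k + b ^ (i + d + 1) + w = (k + w) + (b ^ d * b) * b ^ i := by ring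
  rw [this, Nat.add_mul_div_right _ _ (by positivity), Nat.add_mul_mod_self_right]

lemma sum_digit_progression {α : Type*} [AddCommMonoid α] {b : ℕ} (hb : 0 < b) (i k w : ℕ)
    (g : ℕ → α) :
    ∑ t ∈ range b, g ((k + t * b ^ i + w) / b ^ i % b) = ∑ h ∈ range b, g h := by
  rw [← sum_range_add_mod b ((k + w) / b ^ i) g]
  refine sum_congr rfl fun t _ => ?_
  rw [add_right_comm, Nat.add_mul_div_right _ _ (by positivity)]

lemma sum_digit {b : ℕ} (hb : 0 < b) {i n : ℕ} (hi : i < n) (w : ℕ) (g : ℕ → ℝ) :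
    (b : ℝ) * ∑ k ∈ range (b ^ n), g ((k + w) / b ^ i % b)
      = (b : ℝ) ^ n * ∑ h ∈ range b, g h := by
  have h0 : ∀ m : ℕ, (i < m) → ∀ k : ℕ, g ((k + b ^ m + w) / b ^ i % b) =
      g ((k + w) / b ^ i % b) := fun m hm k => by rw [digit_add_pow hb k w hm]
  have h1 : ∀ t, ∑ k ∈ range (b ^ n), g ((k + t * b ^ i + w) / b ^ i % b)
      = ∑ k ∈ range (b ^ n), g ((k + w) / b ^ i % b) := fun t =>
    sum_range_shift (b ^ n) (fun k => g ((k + w) / b ^ i % b)) (h0 n hi) (t * b ^ i)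
  have h2 : ∑ t ∈ range b, ∑ k ∈ range (b ^ n), g ((k + t * b ^ i + w) / b ^ i % b)
      = (b : ℝ) ^ n * ∑ h ∈ range b, g h := by
    rw [sum_comm]
    simp [sum_digit_progression hb]
  simpa [h1] using h2

end PeriodicSums

section Integrals

lemma integral_eq_sum_of_quadratic_on_cells (M : ℕ) (hM : 0 < M) (f : ℝ → ℝ) (a b c : ℕ → ℝ)
    (h : ∀ k < M, ∀ y ∈ Set.Ioo ((k : ℝ) / M) (((k + 1 : ℕ) : ℝ) / M),
      f y = a k + b k * y + c k * y ^ 2) :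
    ∫ y in (0:ℝ)..1, f y = ∑ k ∈ range M,
      (a k / M + b k * (2 * k + 1) / (2 * M ^ 2) + c k * (3 * k ^ 2 + 3 * k + 1) / (3 * M ^ 3)) := by
  have hM' : (M : ℝ) ≠ 0 := by positivity
  have hle : ∀ k : ℕ, (k : ℝ) / M ≤ ((k + 1 : ℕ) : ℝ) / M := fun k => by
    gcongr; exact_mod_cast Nat.le_succ k
  have hint := intervalIntegral.sum_integral_adjacent_intervals (f := f)
    (μ := MeasureTheory.volume) (a := fun k : ℕ => (k : ℝ) / M) (n := M) (by
      intro k hk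
      refine IntervalIntegrable.congr_uIoo (f := fun y => a k + b k * y + c k * y ^ 2)
        (Continuous.intervalIntegrable (by fun_prop) _ _) ?_
      intro y hy
      rw [Set.uIoo_of_le (hle k)] at hy
      exact (h k hk y hy).symm)
  simp only [Nat.cast_zero, zero_div, div_self hM'] at hint
  rw [← hint]
  refine sum_congr rfl fun k hk => ?_
  rw [intervalIntegral.integral_congr_Ioo_of_le (hle k) (h k (mem_range.mp hk))]
  rw [intervalIntegral.integral_add (Continuous.intervalIntegrable (by fun_prop) _ _)
    (Continuous.intervalIntegrable (by fun_prop) _ _),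
    intervalIntegral.integral_add (Continuous.intervalIntegrable (by fun_prop) _ _)
    (Continuous.intervalIntegrable (by fun_prop) _ _)]
  have hid : ∫ y in (k : ℝ) / M..((k + 1 : ℕ) : ℝ) / M, b k * y
      = b k * (((((k + 1 : ℕ) : ℝ) / M) ^ 2 - ((k : ℝ) / M) ^ 2) / 2) := by
    rw [intervalIntegral.integral_const_mul (b k) (fun y => y), integral_id]
  rw [hid]
  simp only [intervalIntegral.integral_const, intervalIntegral.integral_const_mul,
    integral_pow, smul_eq_mul]
  push_cast
  field_simp
  ring

end Integrals

section Phi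

variable {b : ℕ}

lemma permVal_of_lt (p : Equiv.Perm (Fin b)) {k : ℕ} (hk : k < b) :
    permVal p k = p ⟨k, hk⟩ := by simp [permVal, hk]

lemma permVal_fin (p : Equiv.Perm (Fin b)) (k : Fin b) : permVal p k = p k := by
  simp [permVal]

lemma permVal_lt (hb : 0 < b) (p : Equiv.Perm (Fin b)) (k : ℕ) : permVal p k < b := by
  unfold permVal
  split_ifs <;> simp [hb]

lemma permVal_pbar (p : Equiv.Perm (Fin b)) {k : ℕ} (hk : k < b) :
    permVal (pbar p) k = b - 1 - permVal p k := by
  rw [permVal_of_lt _ hk, permVal_of_lt _ hk]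
  simp [pbar, tauP, Fin.val_rev]
  omega

lemma sum_permVal {α : Type*} [AddCommMonoid α] (p : Equiv.Perm (Fin b)) (f : ℕ → α) :
    ∑ k ∈ range b, f (permVal p k) = ∑ v ∈ range b, f v := by
  rw [← Fin.sum_univ_eq_sum_range, ← Fin.sum_univ_eq_sum_range (fun v => f v)]
  simp only [permVal_fin]
  exact Equiv.sum_comp p (fun i : Fin b => f i)

lemma floor_mul_toNat_lt (hb : 0 < b) (x : ℝ) : (⌊(b : ℝ) * Int.fract x⌋).toNat < b := by
  have h1 : (b : ℝ) * Int.fract x < b := by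
    have : (0 : ℝ) < b := by positivity
    nlinarith [Int.fract_lt_one x]
  have h2 : ⌊(b : ℝ) * Int.fract x⌋ < (b : ℤ) := Int.floor_lt.mpr (by exact_mod_cast h1)
  omega

/-- `phi` as a truncated counting function interpolated linearly, minus its mean. -/
lemma phi_eq (p : Equiv.Perm (Fin b)) (h : ℕ) (x : ℝ) :
    phi p h x = ∑ l ∈ range (⌊(b : ℝ) * Int.fract x⌋).toNat, (if permVal p l < h then (1:ℝ) else 0)
      + (if permVal p (⌊(b : ℝ) * Int.fract x⌋).toNat < h then
          (b : ℝ) * Int.fract x - (⌊(b : ℝ) * Int.fract x⌋).toNat else 0) - h * Int.fract x := by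
  unfold phi
  generalize (⌊(b : ℝ) * Int.fract x⌋).toNat = k
  rw [card_filter, card_filter, sum_range_succ, sum_range_succ]
  split_ifs with h1 h2
  · omega
  · push_cast; ring
  · have : ∀ l, (if h ≤ permVal p l then (1:ℕ) else 0 : ℕ)
        = (1 : ℝ) - if permVal p l < h then (1:ℝ) else 0 := by
      intro l; split_ifs <;> first | omega | simp
    push_cast [this]
    simp only [sum_sub_distrib]
    simp
    ring
  · omega

lemma phi_add_nat (p : Equiv.Perm (Fin b)) (h : ℕ) (x : ℝ) (u : ℕ) :
    phi p h (x + u) = phi p h x := by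
  simp [phi]

lemma phi_zero_left (p : Equiv.Perm (Fin b)) (x : ℝ) : phi p 0 x = 0 := by
  simp [phi]

lemma phi_natCast (p : Equiv.Perm (Fin b)) (h u : ℕ) : phi p h (u : ℝ) = 0 := by
  rw [phi_eq]; simp

lemma phi_top (hb : 0 < b) (p : Equiv.Perm (Fin b)) (x : ℝ) : phi p b x = 0 := by
  rw [phi_eq]; simp [permVal_lt hb]

lemma phi_pbar (hb : 0 < b) (p : Equiv.Perm (Fin b)) {h : ℕ} (hh : h ≤ b) (x : ℝ) :
    phi (pbar p) h x = - phi p (b - h) x := by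
  rw [phi_eq, phi_eq]
  have hk := floor_mul_toNat_lt hb x
  generalize (⌊(b : ℝ) * Int.fract x⌋).toNat = k at *
  have key : ∀ l, l < b → (permVal (pbar p) l < h ↔ ¬ permVal p l < b - h) := by
    intro l hl
    have := permVal_lt hb p l
    rw [permVal_pbar p hl]; omega
  have h1 : ∑ l ∈ range k, (if permVal (pbar p) l < h then (1:ℝ) else 0)
      = k - ∑ l ∈ range k, (if permVal p l < b - h then (1:ℝ) else 0) := by
    rw [eq_sub_iff_add_eq, ← sum_add_distrib]
    rw [sum_congr rfl (g := fun _ => (1:ℝ))]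
    · simp
    intro l hl
    simp only [key l ((mem_range.mp hl).trans hk)]
    split_ifs <;> simp
  rw [h1]
  simp only [key k hk]
  push_cast [Nat.cast_sub hh]
  split_ifs <;> ring

lemma sum_phi_pbar {α : Type*} [AddCommMonoid α] (hb : 0 < b) (p : Equiv.Perm (Fin b)) (x : ℝ)
    (f : ℝ → α) :
    ∑ h ∈ range b, f (phi (pbar p) h x) = ∑ h ∈ range b, f (- phi p h x) := by
  rw [← sum_range_shift_one b (fun h => f (- phi p h x)) (by rw [phi_top hb, phi_zero_left]),
    ← sum_range_reflect]
  refine sum_congr rfl fun h hh => ?_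
  have := mem_range.mp hh
  rw [phi_pbar hb p (by omega)]
  congr 4; omega

end Phi

section PhiSquares

variable {b : ℕ}

lemma phi_cell (hb : 0 < b) (p : Equiv.Perm (Fin b)) (h : ℕ) {i N : ℕ} (hN : N < b ^ (i + 1))
    {x : ℝ} (hx1 : (N : ℝ) / (b : ℝ) ^ (i + 1) ≤ x)
    (hx2 : x < ((N + 1 : ℕ) : ℝ) / (b : ℝ) ^ (i + 1)) :
    phi p h x = ∑ l ∈ range (N / b ^ i), (if permVal p l < h then (1:ℝ) else 0)
      + (if permVal p (N / b ^ i) < h then (b : ℝ) * x - (N / b ^ i : ℕ) else 0) - h * x := by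
  have hb' : (0 : ℝ) < b := by exact_mod_cast hb
  have hB : (0 : ℝ) < (b : ℝ) ^ i := by positivity
  have hK : (0 : ℝ) < (b : ℝ) ^ (i + 1) := by positivity
  rw [div_le_iff₀ hK] at hx1
  rw [lt_div_iff₀ hK] at hx2
  have hx0 : 0 ≤ x := by
    by_contra hneg
    push Not at hneg
    have : x * (b : ℝ) ^ (i + 1) < 0 := mul_neg_of_neg_of_pos hneg hK
    have : (0 : ℝ) ≤ N := Nat.cast_nonneg N
    linarith
  have hx3 : x < 1 := by
    by_contra hge
    push Not at hge
    have h1 : ((N + 1 : ℕ) : ℝ) ≤ (b : ℝ) ^ (i + 1) := by exact_mod_cast hN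
    nlinarith
  have hfr : Int.fract x = x := Int.fract_eq_self.mpr ⟨hx0, hx3⟩
  have hfl : ⌊(b : ℝ) * x⌋ = ((N / b ^ i : ℕ) : ℤ) := by
    rw [Int.floor_eq_iff]
    have h1 : N / b ^ i * b ^ i ≤ N := Nat.div_mul_le_self _ _
    have h2 : N + 1 ≤ (N / b ^ i + 1) * b ^ i := by
      have := Nat.lt_div_mul_add (a := N) (b := b ^ i) (by positivity)
      rw [Nat.add_mul, one_mul]; omega
    have h1' : ((N / b ^ i : ℕ) : ℝ) * (b : ℝ) ^ i ≤ N := by exact_mod_cast h1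
    have h2' : ((N + 1 : ℕ) : ℝ) ≤ (((N / b ^ i : ℕ) : ℝ) + 1) * (b : ℝ) ^ i := by exact_mod_cast h2
    rw [pow_succ] at hx1 hx2
    simp only [Int.cast_natCast]
    constructor
    · refine le_of_mul_le_mul_right (a := (b : ℝ) ^ i) ?_ hB
      linarith
    · refine lt_of_mul_lt_mul_right (a := (b : ℝ) ^ i) ?_ hB.le
      linarith
  rw [phi_eq, hfr, hfl, Int.toNat_natCast]

lemma phi_grid (hb : 0 < b) (p : Equiv.Perm (Fin b)) (h : ℕ) {i N : ℕ} (hN : N < b ^ (i + 1)) :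
    phi p h ((N : ℝ) / (b : ℝ) ^ (i + 1)) =
      ∑ l ∈ range (N / b ^ i), (if permVal p l < h then (1:ℝ) else 0)
      + (if permVal p (N / b ^ i) < h then ((N % b ^ i : ℕ) : ℝ) / (b : ℝ) ^ i else 0)
      - h * ((N : ℝ) / (b : ℝ) ^ (i + 1)) := by
  have hb' : (0 : ℝ) < b := by exact_mod_cast hb
  rw [phi_cell hb p h hN le_rfl]
  · congr 2
    refine if_congr Iff.rfl ?_ rfl
    have : ((b ^ i * (N / b ^ i) + N % b ^ i : ℕ) : ℝ) = N := by rw [Nat.div_add_mod]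
    push_cast at this
    rw [← this]
    field_simp
    ring
  · gcongr; exact Nat.lt_succ_self N

lemma sum_range_div {B : ℕ} (hB : 0 < B) (g : ℕ → ℝ) (q r : ℕ) (hr : r ≤ B) :
    ∑ k ∈ range (q * B + r), g (k / B) = B * ∑ l ∈ range q, g l + r * g q := by
  have h1 : ∀ s ≤ B, ∀ q : ℕ, ∑ k ∈ range s, g ((q * B + k) / B) = s * g q := by
    intro s hs q
    rw [sum_congr rfl (g := fun _ => g q)]
    · simp
    · intro k hk
      have := mem_range.mp hk
      congr 1
      rw [add_comm, Nat.add_mul_div_right _ _ hB, Nat.div_eq_of_lt (by omega), zero_add]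
  rw [sum_range_add, sum_range_mul_eq, h1 r hr, mul_sum]
  congr 1
  exact sum_congr rfl fun l _ => h1 B le_rfl l

lemma sum_indicator_lt {h : ℕ} (hh : h ≤ b) :
    ∑ v ∈ range b, (if v < h then (1:ℝ) else 0) = h := by
  rw [sum_ite, sum_const_zero, add_zero]
  have : (range b).filter (fun v => v < h) = range h := by
    ext v; simp only [mem_filter, mem_range]; omega
  rw [this]; simp

/-- The slope of `phi p h` on the `k`-th of `b` cells. -/
def slope (p : Equiv.Perm (Fin b)) (h k : ℕ) : ℝ :=
  b * (if permVal p k < h then (1:ℝ) else 0) - h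

lemma sum_slope (p : Equiv.Perm (Fin b)) {h : ℕ} (hh : h ≤ b) :
    ∑ k ∈ range b, slope p h k = 0 := by
  unfold slope
  rw [sum_permVal p (fun v => (b : ℝ) * (if v < h then (1:ℝ) else 0) - h), sum_sub_distrib,
    ← mul_sum, sum_indicator_lt hh]
  simp

lemma sum_slope_sq (p : Equiv.Perm (Fin b)) {h : ℕ} (hh : h ≤ b) :
    ∑ k ∈ range b, slope p h k ^ 2 = b * (h * (b - h)) := by
  unfold slope
  rw [sum_permVal p (fun v => ((b : ℝ) * (if v < h then (1:ℝ) else 0) - h) ^ 2)]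
  have : ∀ v : ℕ, ((b : ℝ) * (if v < h then (1:ℝ) else 0) - h) ^ 2
      = ((b : ℝ) ^ 2 - 2 * b * h) * (if v < h then (1:ℝ) else 0) + h ^ 2 := by
    intro v; split_ifs <;> ring
  simp only [this]
  rw [sum_add_distrib, ← mul_sum, sum_indicator_lt hh]
  simp
  ring

lemma sum_mul_sub (m : ℕ) (c : ℝ) :
    ∑ h ∈ range m, (h : ℝ) * (c - h) = c * m * (m - 1) / 2 - m * (m - 1) * (2 * m - 1) / 6 := by
  induction m with
  | zero => simp
  | succ m ih => rw [sum_range_succ, ih]; push_cast; ring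

lemma phi_grid_eq_sum_slope (hb : 0 < b) (p : Equiv.Perm (Fin b)) (h : ℕ) {i N : ℕ}
    (hN : N < b ^ (i + 1)) :
    phi p h ((N : ℝ) / (b : ℝ) ^ (i + 1)) =
      (∑ k ∈ range N, slope p h (k / b ^ i)) / (b : ℝ) ^ (i + 1) := by
  have hb' : (0 : ℝ) < b := by exact_mod_cast hb
  have hmod := Nat.div_add_mod N (b ^ i)
  have hcast : (N : ℝ) = (b : ℝ) ^ i * (N / b ^ i : ℕ) + (N % b ^ i : ℕ) := by
    exact_mod_cast hmod.symm
  have h1 := sum_range_div (B := b ^ i) (by positivity) (slope p h) (N / b ^ i) (N % b ^ i)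
    (Nat.mod_lt _ (by positivity)).le
  rw [mul_comm (N / b ^ i), hmod] at h1
  rw [phi_grid hb p h hN, h1]
  unfold slope
  rw [sum_sub_distrib, ← mul_sum]
  simp only [sum_const, card_range, nsmul_eq_mul]
  generalize ∑ l ∈ range (N / b ^ i), (if permVal p l < h then (1:ℝ) else 0) = A
  rw [hcast]
  push_cast
  generalize ((N / b ^ i : ℕ) : ℝ) = u
  generalize ((N % b ^ i : ℕ) : ℝ) = v
  split_ifs <;> (field_simp; ring)

lemma sum_phi_sq_grid (hb : 0 < b) (p : Equiv.Perm (Fin b)) (i : ℕ) :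
    ∑ N ∈ range (b ^ (i + 1)), ∑ h ∈ range b, phi p h ((N : ℝ) / (b : ℝ) ^ (i + 1)) ^ 2
      = (b : ℝ) ^ (i + 1) * (∫ x in (0:ℝ)..1, phiS2 p x)
        + b * ((b : ℝ) ^ 2 - 1) / (36 * (b : ℝ) ^ (i + 1)) := by
  have hb' : (0 : ℝ) < b := by exact_mod_cast hb
  set K : ℝ := (b : ℝ) ^ (i + 1) with hKdef
  have hK : 0 < K := by positivity
  set P : ℕ → ℕ → ℝ := fun h N => (∑ k ∈ range N, slope p h (k / b ^ i)) / K with hP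
  set s : ℕ → ℕ → ℝ := fun h N => slope p h (N / b ^ i) with hs
  have hphi : ∀ h N, N < b ^ (i + 1) → phi p h ((N : ℝ) / K) = P h N := fun h N hN =>
    phi_grid_eq_sum_slope hb p h hN
  have hPsucc : ∀ h N, P h (N + 1) = P h N + s h N / K := by
    intro h N
    simp only [hP, hs, sum_range_succ, add_div]
  have hPend : ∀ h ≤ b, P h (b ^ (i + 1)) = 0 := by
    intro h hh
    have h1 := sum_range_div (B := b ^ i) (by positivity) (slope p h) b 0 (by positivity)
    rw [sum_slope p hh] at h1
    simp only [hP, pow_succ']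
    simp only [add_zero, mul_zero, Nat.cast_zero, zero_mul] at h1
    rw [h1, zero_div]
  have hss : ∀ h ≤ b, ∑ N ∈ range (b ^ (i + 1)), s h N ^ 2 = K * (h * (b - h)) := by
    intro h hh
    have h1 := sum_range_div (B := b ^ i) (by positivity) (fun k => slope p h k ^ 2) b 0
      (by positivity)
    rw [sum_slope_sq p hh] at h1
    simp only [add_zero, Nat.cast_zero, zero_mul] at h1
    simp only [hs, pow_succ' b i]
    rw [h1, hKdef]
    push_cast
    ring
  have htel : ∀ h ≤ b, ∑ N ∈ range (b ^ (i + 1)), (2 * (P h N * s h N) / K + s h N ^ 2 / K ^ 2)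
      = 0 := by
    intro h hh
    have h1 := sum_range_sub (fun N => P h N ^ 2) (b ^ (i + 1))
    rw [hPend h hh] at h1
    have h2 : P h 0 = 0 := by simp [hP]
    rw [h2] at h1
    rw [sub_self] at h1
    rw [← h1]
    refine sum_congr rfl fun N _ => ?_
    rw [hPsucc]
    ring
  have hint : ∫ x in (0:ℝ)..1, phiS2 p x = ∑ N ∈ range (b ^ (i + 1)), ∑ h ∈ range b,
      (P h N ^ 2 / K + P h N * s h N / K ^ 2 + s h N ^ 2 / (3 * K ^ 3)) := by
    rw [integral_eq_sum_of_quadratic_on_cells (b ^ (i + 1)) (by positivity) (phiS2 p)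
      (fun N => ∑ h ∈ range b, (P h N - s h N * (N / K)) ^ 2)
      (fun N => ∑ h ∈ range b, 2 * s h N * (P h N - s h N * (N / K)))
      (fun N => ∑ h ∈ range b, s h N ^ 2)]
    · refine sum_congr rfl fun N _ => ?_
      push_cast
      rw [← hKdef]
      simp only [sum_div, sum_mul, ← sum_add_distrib]
      refine sum_congr rfl fun h _ => ?_
      field_simp
      ring
    · intro N hN y hy
      push_cast at hy
      rw [← hKdef] at hy
      simp only [phiS2, sum_mul, ← sum_add_distrib]
      refine sum_congr rfl fun h _ => ?_
      have h1 := phi_cell hb p h hN (x := y) hy.1.le (by push_cast; exact hy.2)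
      have h2 := phi_cell hb p h hN (x := N / K) le_rfl (by
        rw [← hKdef]; gcongr; exact Nat.lt_succ_self N)
      have h3 : phi p h y = P h N + s h N * (y - N / K) := by
        rw [h1, ← hphi h N hN, h2]
        simp only [hs, slope]
        split_ifs <;> ring
      rw [h3]
      ring
  rw [hint, sum_comm, sum_comm (s := range (b ^ (i + 1))) (t := range b), mul_sum]
  have hfin : ∑ h ∈ range b, ((h : ℝ) * (b - h)) = b * ((b : ℝ) ^ 2 - 1) / 6 := by
    rw [sum_mul_sub]; ring
  have : b * ((b : ℝ) ^ 2 - 1) / (36 * K) = ∑ h ∈ range b, ((h : ℝ) * (b - h)) / (6 * K) := by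
    rw [← sum_div, hfin]; field_simp; norm_num
  rw [this, ← sum_add_distrib]
  refine sum_congr rfl fun h hh => ?_
  have hh' := (mem_range.mp hh).le
  have e1 := htel h hh'
  have e2 := hss h hh'
  rw [sum_congr rfl fun N hN => by rw [hphi h N (mem_range.mp hN)]]
  simp only [sum_add_distrib, ← sum_div, ← mul_sum] at e1 ⊢
  rw [e2] at e1 ⊢
  field_simp at e1 ⊢
  linear_combination (-9) * e1

end PhiSquares

section Carry

variable {b : ℕ}

/-- The sequence of reflected permutations. -/
def bar (R : ℕ → Equiv.Perm (Fin b)) : ℕ → Equiv.Perm (Fin b) := fun l => pbar (R l)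

lemma pbar_pbar (p : Equiv.Perm (Fin b)) : pbar (pbar p) = p := by
  ext k; simp [pbar, tauP]

lemma bar_bar (R : ℕ → Equiv.Perm (Fin b)) : bar (bar R) = R := by
  funext l; exact pbar_pbar (R l)

/-- The integer whose `i` base-`b` digits are the images under `R` of the leading `i` digits
of the `n`-digit number `N`, in reversed order. -/
def carry (R : ℕ → Equiv.Perm (Fin b)) (n i N : ℕ) : ℕ :=
  ∑ l ∈ range i, permVal (R l) (N / b ^ (n - 1 - l) % b) * b ^ l

lemma carry_bar_add (hb : 0 < b) (R : ℕ → Equiv.Perm (Fin b)) (n i N : ℕ) :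
    carry (bar R) n i N + carry R n i N + 1 = b ^ i := by
  induction i with
  | zero => simp [carry]
  | succ i ih =>
    unfold carry at *
    rw [sum_range_succ, sum_range_succ]
    have hlt := permVal_lt hb (R i) (N / b ^ (n - 1 - i) % b)
    have h1 : permVal (bar R i) (N / b ^ (n - 1 - i) % b)
        = b - 1 - permVal (R i) (N / b ^ (n - 1 - i) % b) := permVal_pbar _ (Nat.mod_lt _ hb)
    have h2 : permVal (bar R i) (N / b ^ (n - 1 - i) % b)
        + permVal (R i) (N / b ^ (n - 1 - i) % b) + 1 = b := by omega
    calc _ = (∑ l ∈ range i, permVal (bar R l) (N / b ^ (n - 1 - l) % b) * b ^ l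
          + ∑ l ∈ range i, permVal (R l) (N / b ^ (n - 1 - l) % b) * b ^ l + 1)
          + (permVal (bar R i) (N / b ^ (n - 1 - i) % b)
          + permVal (R i) (N / b ^ (n - 1 - i) % b)) * b ^ i := by ring
      _ = (permVal (bar R i) (N / b ^ (n - 1 - i) % b)
          + permVal (R i) (N / b ^ (n - 1 - i) % b) + 1) * b ^ i := by rw [ih]; ring
      _ = b ^ (i + 1) := by rw [h2]; ring

lemma carry_bar (hb : 0 < b) (R : ℕ → Equiv.Perm (Fin b)) (n i N : ℕ) :
    carry (bar R) n i N = b ^ i - 1 - carry R n i N := by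
  have := carry_bar_add hb R n i N
  omega

lemma carry_eq_carry_div (R : ℕ → Equiv.Perm (Fin b)) {n i : ℕ} (hi : i ≤ n) (N : ℕ) :
    carry R n i N = carry R i i (N / b ^ (n - i)) := by
  unfold carry
  refine sum_congr rfl fun l hl => ?_
  have := mem_range.mp hl
  rw [Nat.div_div_eq_div_mul, ← pow_add]
  congr 5; omega

lemma carry_succ_self (R : ℕ → Equiv.Perm (Fin b)) (i u : ℕ) :
    carry R (i + 1) (i + 1) u = carry R i i (u / b) + permVal (R i) (u % b) * b ^ i := by
  unfold carry
  rw [sum_range_succ]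
  congr 1
  · refine sum_congr rfl fun l hl => ?_
    have := mem_range.mp hl
    rw [Nat.div_div_eq_div_mul, ← pow_succ']
    congr 5; omega
  · simp

lemma sum_carry {α : Type*} [AddCommMonoid α] (hb : 0 < b) (R : ℕ → Equiv.Perm (Fin b)) (i : ℕ)
    (f : ℕ → α) :
    ∑ u ∈ range (b ^ i), f (carry R i i u) = ∑ v ∈ range (b ^ i), f v := by
  induction i generalizing f with
  | zero => simp [carry]
  | succ i ih =>
    rw [pow_succ, sum_range_mul_eq]
    have h1 : ∀ q ∈ range (b ^ i), ∑ r ∈ range b, f (carry R (i + 1) (i + 1) (q * b + r))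
        = ∑ v ∈ range b, f (carry R i i q + v * b ^ i) := by
      intro q _
      rw [← sum_permVal (R i) (fun v => f (carry R i i q + v * b ^ i))]
      refine sum_congr rfl fun r hr => ?_
      have hr' := mem_range.mp hr
      rw [carry_succ_self, add_comm (q * b), Nat.add_mul_div_right _ _ hb, Nat.div_eq_of_lt hr',
        Nat.add_mul_mod_self_right, Nat.mod_eq_of_lt hr', zero_add]
    rw [sum_congr rfl h1, ih (fun w => ∑ v ∈ range b, f (w + v * b ^ i)), sum_comm,
      mul_comm (b ^ i), sum_range_mul_eq]
    exact sum_congr rfl fun v _ => sum_congr rfl fun w _ => by rw [add_comm]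

lemma div_pow_mod_pow (N : ℕ) {n k : ℕ} (hk : k < n) : N % b ^ n / b ^ k % b = N / b ^ k % b := by
  obtain ⟨d, rfl⟩ := Nat.exists_eq_add_of_lt hk
  rw [show b ^ (k + d + 1) = b ^ k * (b ^ d * b) by ring, Nat.mod_mul_right_div_self,
    Nat.mod_mul_left_mod]

lemma carry_succ_succ (R : ℕ → Equiv.Perm (Fin b)) {n i : ℕ} (hi : i ≤ n) (N : ℕ) :
    carry R (n + 1) (i + 1) N = permVal (R 0) (N / b ^ n % b)
      + b * carry (fun l => R (l + 1)) n i (N % b ^ n) := by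
  unfold carry
  rw [sum_range_succ', add_comm, mul_sum]
  congr 1
  · simp
  · refine sum_congr rfl fun l hl => ?_
    have := mem_range.mp hl
    rw [div_pow_mod_pow N (by omega), show n + 1 - 1 - (l + 1) = n - 1 - l by omega]
    ring

end Carry

section Terms

variable {b : ℕ}

/-- The contribution of the `i`-th digit to the local discrepancy at the grid point
`(L / b ^ n, N / b ^ n)`. -/
def term (R : ℕ → Equiv.Perm (Fin b)) (n i L N : ℕ) : ℝ :=
  phi (R i) ((L + carry (bar R) n i N) / b ^ i % b) ((N : ℝ) / (b : ℝ) ^ (n - i))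

/-- The contribution of the `i`-th digit to the symmetrized local discrepancy. -/
def symTerm (R : ℕ → Equiv.Perm (Fin b)) (n i L N : ℕ) : ℝ :=
  term R n i L N + term (bar R) n i L N

lemma term_add_pow (hb : 0 < b) (R : ℕ → Equiv.Perm (Fin b)) (n L N : ℕ) {i e : ℕ} (h : i < e) :
    term R n i (L + b ^ e) N = term R n i L N := by
  unfold term
  rw [digit_add_pow hb _ _ h]

lemma symTerm_add_pow (hb : 0 < b) (R : ℕ → Equiv.Perm (Fin b)) (n L N : ℕ) {i e : ℕ}
    (h : i < e) : symTerm R n i (L + b ^ e) N = symTerm R n i L N := by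
  unfold symTerm
  rw [term_add_pow hb _ _ _ _ h, term_add_pow hb _ _ _ _ h]

lemma sum_symTerm_progression (hb : 0 < b) (R : ℕ → Equiv.Perm (Fin b)) (n i L N : ℕ) :
    ∑ t ∈ range b, symTerm R n i (L + t * b ^ i) N = 0 := by
  unfold symTerm term
  rw [sum_add_distrib,
    sum_digit_progression hb i L _ (fun h => phi (R i) h ((N : ℝ) / (b : ℝ) ^ (n - i))),
    sum_digit_progression hb i L _ (fun h => phi (bar R i) h ((N : ℝ) / (b : ℝ) ^ (n - i)))]
  have := sum_phi_pbar hb (R i) ((N : ℝ) / (b : ℝ) ^ (n - i)) (fun x => x)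
  simp only [bar, this, sum_neg_distrib, add_neg_cancel]

lemma sum_symTerm_mul (hb : 0 < b) (R : ℕ → Equiv.Perm (Fin b)) (n N : ℕ) {i j : ℕ}
    (hij : i < j) (hj : j < n) :
    ∑ L ∈ range (b ^ n), symTerm R n i L N * symTerm R n j L N = 0 :=
  sum_mul_eq_zero_of_averages (b ^ n) (b ^ j) b hb (fun L => symTerm R n i L N)
    (fun L => symTerm R n j L N) (fun L => symTerm_add_pow hb R n L N hij)
    (fun L => symTerm_add_pow hb R n L N (hij.trans hj))
    (fun L => symTerm_add_pow hb R n L N hj)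
    (fun L => sum_symTerm_progression hb R n j L N)

lemma sum_sq_sum_symTerm (hb : 0 < b) (R : ℕ → Equiv.Perm (Fin b)) (n N : ℕ) :
    ∑ L ∈ range (b ^ n), (∑ i ∈ range n, symTerm R n i L N) ^ 2
      = ∑ i ∈ range n, ∑ L ∈ range (b ^ n), symTerm R n i L N ^ 2 := by
  have h1 : ∀ L, (∑ i ∈ range n, symTerm R n i L N) ^ 2
      = ∑ i ∈ range n, ∑ j ∈ range n, symTerm R n i L N * symTerm R n j L N := by
    intro L; rw [sq, sum_mul_sum]
  simp only [h1]
  rw [sum_comm]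
  refine sum_congr rfl fun i hi => ?_
  rw [sum_comm, sum_eq_single_of_mem i hi]
  · simp only [sq]
  · intro j hj hne
    rcases lt_or_gt_of_ne hne with h | h
    · rw [← sum_symTerm_mul hb R n N h (mem_range.mp hi)]
      exact sum_congr rfl fun L _ => mul_comm _ _
    · exact sum_symTerm_mul hb R n N h (mem_range.mp hj)

lemma PhiS2_pbar (hb : 0 < b) (p : Equiv.Perm (Fin b)) : PhiS2 (pbar p) = PhiS2 p := by
  have : phiS2 (pbar p) = phiS2 p := by
    funext x
    simp only [phiS2, sum_phi_pbar hb p x (fun y => y ^ 2), neg_sq]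
  simp only [PhiS2, this]

lemma sum_grid_split {α : Type*} [AddCommMonoid α] (n : ℕ) {i : ℕ} (hi : i ≤ n) (hb : 0 < b)
    (F : ℕ → ℝ → α) (hF : ∀ k x (u : ℕ), F k (x + u) = F k x) :
    ∑ N ∈ range (b ^ n), F (N / b ^ (n - i)) ((N : ℝ) / (b : ℝ) ^ (n - i))
      = ∑ u ∈ range (b ^ i), ∑ r ∈ range (b ^ (n - i)), F u ((r : ℝ) / (b : ℝ) ^ (n - i)) := by
  have hb' : (0 : ℝ) < b := by exact_mod_cast hb
  obtain ⟨d, rfl⟩ := Nat.exists_eq_add_of_le hi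
  rw [Nat.add_sub_cancel_left, pow_add, sum_range_mul_eq]
  refine sum_congr rfl fun u _ => sum_congr rfl fun r hr => ?_
  rw [← hF u _ u, add_comm (u * b ^ d), Nat.add_mul_div_right _ _ (by positivity),
    Nat.div_eq_of_lt (mem_range.mp hr), zero_add]
  congr 1
  push_cast
  field_simp

lemma sum_term_sq (hb : 0 < b) (R : ℕ → Equiv.Perm (Fin b)) {n i : ℕ} (hi : i < n) :
    ∑ N ∈ range (b ^ n), ∑ L ∈ range (b ^ n), term R n i L N ^ 2
      = (b : ℝ) ^ (2 * n) * PhiS2 (R i) + (b : ℝ) ^ (2 * i) * ((b : ℝ) ^ 2 - 1) / 36 := by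
  have hb' : (0 : ℝ) < b := by exact_mod_cast hb
  have h1 : ∀ N, (b : ℝ) * ∑ L ∈ range (b ^ n), term R n i L N ^ 2
      = (b : ℝ) ^ n * ∑ h ∈ range b, phi (R i) h ((N : ℝ) / (b : ℝ) ^ (n - i)) ^ 2 := fun N =>
    sum_digit hb hi (carry (bar R) n i N)
      (fun h => phi (R i) h ((N : ℝ) / (b : ℝ) ^ (n - i)) ^ 2)
  have h2 := sum_grid_split (b := b) n hi.le hb
    (fun _ x => ∑ h ∈ range b, phi (R i) h x ^ 2) (fun _ x u => by simp only [phi_add_nat])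
  obtain ⟨d, rfl⟩ := Nat.exists_eq_add_of_lt hi
  have hsub : i + d + 1 - i = d + 1 := by omega
  rw [hsub] at h1 h2
  rw [sum_const, card_range, nsmul_eq_mul, sum_phi_sq_grid hb (R i) d] at h2
  refine mul_left_cancel₀ hb'.ne' ?_
  rw [mul_sum]
  simp only [h1]
  rw [← mul_sum, h2, PhiS2]
  push_cast
  field_simp
  ring

/-- The mixed second moment of the `m`-th digit contributions of `R` and `bar R`. -/
def mixed (p : Equiv.Perm (Fin b)) (n m : ℕ) : ℝ :=
  ∑ u ∈ range (b ^ m), ∑ r ∈ range (b ^ (n - m)), ∑ L ∈ range (b ^ n),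
    phi p ((L + (b ^ m - 1 - u)) / b ^ m % b) ((r : ℝ) / (b : ℝ) ^ (n - m)) *
      phi (pbar p) ((L + u) / b ^ m % b) ((r : ℝ) / (b : ℝ) ^ (n - m))

lemma mixed_pbar (p : Equiv.Perm (Fin b)) (n m : ℕ) : mixed (pbar p) n m = mixed p n m := by
  unfold mixed
  rw [← sum_range_reflect]
  refine sum_congr rfl fun u hu => sum_congr rfl fun r _ => sum_congr rfl fun L _ => ?_
  have := mem_range.mp hu
  rw [pbar_pbar, mul_comm, show b ^ m - 1 - (b ^ m - 1 - u) = u by omega]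

lemma sum_phi_mul_phi_pbar (hb : 0 < b) (R : ℕ → Equiv.Perm (Fin b)) (p : Equiv.Perm (Fin b))
    {n m : ℕ} (hm : m ≤ n) :
    ∑ N ∈ range (b ^ n), ∑ L ∈ range (b ^ n),
      phi p ((L + carry (bar R) n m N) / b ^ m % b) ((N : ℝ) / (b : ℝ) ^ (n - m)) *
        phi (pbar p) ((L + carry R n m N) / b ^ m % b) ((N : ℝ) / (b : ℝ) ^ (n - m))
      = mixed p n m := by
  have h := sum_grid_split (b := b) n hm hb (fun k x => ∑ L ∈ range (b ^ n),
      phi p ((L + (b ^ m - 1 - carry R m m k)) / b ^ m % b) x *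
        phi (pbar p) ((L + carry R m m k) / b ^ m % b) x)
      (fun k x u => by simp only [phi_add_nat])
  simp only [carry_bar hb, carry_eq_carry_div R hm]
  exact h.trans (sum_carry hb R m (fun u => ∑ r ∈ range (b ^ (n - m)), ∑ L ∈ range (b ^ n),
    phi p ((L + (b ^ m - 1 - u)) / b ^ m % b) ((r : ℝ) / (b : ℝ) ^ (n - m)) *
      phi (pbar p) ((L + u) / b ^ m % b) ((r : ℝ) / (b : ℝ) ^ (n - m))))

lemma sum_symTerm_sq (hb : 0 < b) (R : ℕ → Equiv.Perm (Fin b)) (σ : Equiv.Perm (Fin b))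
    {n i : ℕ} (hi : i < n) (hR : R i = σ ∨ R i = pbar σ) :
    ∑ N ∈ range (b ^ n), ∑ L ∈ range (b ^ n), symTerm R n i L N ^ 2
      = 2 * (b : ℝ) ^ (2 * n) * PhiS2 σ + (b : ℝ) ^ (2 * i) * ((b : ℝ) ^ 2 - 1) / 18
        + 2 * mixed σ n i := by
  have h1 : PhiS2 (R i) = PhiS2 σ := by
    rcases hR with h | h <;> simp [h, PhiS2_pbar hb]
  have h2 : mixed (R i) n i = mixed σ n i := by
    rcases hR with h | h <;> simp [h, mixed_pbar]
  have h3 := sum_phi_mul_phi_pbar hb R (R i) hi.le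
  have h4 : ∑ N ∈ range (b ^ n), ∑ L ∈ range (b ^ n), term R n i L N * term (bar R) n i L N
      = mixed (R i) n i := by
    rw [← h3]
    unfold term
    rw [bar_bar]
    rfl
  have h5 := sum_term_sq hb R hi
  have h6 := sum_term_sq hb (bar R) hi
  rw [show bar R i = pbar (R i) from rfl, PhiS2_pbar hb] at h6
  have h7 : ∀ L N, symTerm R n i L N ^ 2 = term R n i L N ^ 2 + term (bar R) n i L N ^ 2
      + 2 * (term R n i L N * term (bar R) n i L N) := fun L N => by unfold symTerm; ring
  simp only [h7, sum_add_distrib, ← mul_sum]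
  rw [h4, h5, h6, h1, h2]
  ring

lemma sum_sq_symTerm_total (hb : 0 < b) (R : ℕ → Equiv.Perm (Fin b)) (σ : Equiv.Perm (Fin b))
    (n : ℕ) (hR : ∀ i, R i = σ ∨ R i = pbar σ) :
    ∑ N ∈ range (b ^ n), ∑ L ∈ range (b ^ n), (∑ i ∈ range n, symTerm R n i L N) ^ 2
      = 2 * n * (b : ℝ) ^ (2 * n) * PhiS2 σ + ((b : ℝ) ^ (2 * n) - 1) / 18
        + 2 * ∑ i ∈ range n, mixed σ n i := by
  simp only [sum_sq_sum_symTerm hb]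
  rw [sum_comm, sum_congr rfl fun i hi => sum_symTerm_sq hb R σ (mem_range.mp hi) (hR i)]
  have hgeom : ∑ i ∈ range n, (b : ℝ) ^ (2 * i) * ((b : ℝ) ^ 2 - 1) = (b : ℝ) ^ (2 * n) - 1 := by
    rw [← sum_mul]
    simp only [pow_mul]
    exact geom_sum_mul _ _
  rw [sum_add_distrib, sum_add_distrib, ← sum_div, hgeom, ← mul_sum _ (fun i => mixed σ n i)]
  simp only [sum_const, card_range, nsmul_eq_mul]
  ring

end Terms

section Eps

variable {b : ℕ}

lemma nu_eq_carry (R : ℕ → Equiv.Perm (Fin b)) (n N j : ℕ) :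
    nu b n (fun i => R i) N j = carry (fun l => R (n - 1 - l)) n (n - j) N := by
  unfold nu carry
  rw [Fin.sum_univ_eq_sum_range (fun i => if j ≤ i then
    permVal (R i) (N / b ^ i % b) * b ^ (n - 1 - i) else 0), ← sum_range_reflect, ← sum_filter]
  have hset : (range n).filter (fun l => j ≤ n - 1 - l) = range (n - j) := by
    ext l; simp only [mem_filter, mem_range]; omega
  rw [hset]
  refine sum_congr rfl fun l hl => ?_
  have := mem_range.mp hl
  rw [show n - 1 - (n - 1 - l) = l by omega]

lemma eps_eq (hb : 0 < b) (R : ℕ → Equiv.Perm (Fin b)) {n L N j : ℕ} (hL : L < b ^ n)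
    (hN : N < b ^ n) (hj : j ≤ n) :
    eps b n (fun i => R i) L N j =
      (L + carry (bar fun l => R (n - 1 - l)) n (n - j) N) / b ^ (n - j) % b := by
  unfold eps
  rw [if_neg (by omega), carry_bar hb, nu_eq_carry]
  have hlt := carry_bar_add hb (fun l => R (n - 1 - l)) n (n - j) N
  split_ifs with h1 h2
  · subst h1; simp [carry]
  all_goals
    generalize carry (fun l => R (n - 1 - l)) n (n - j) N = ν at *
    generalize n - j = m at *
    have hB : 0 < b ^ m := by positivity
    have hL' : L + (b ^ m - 1 - ν) = L % b ^ (m + 1) + (b ^ m - 1 - ν)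
        + (L / b ^ (m + 1) * b) * b ^ m := by
      have := Nat.mod_add_div L (b ^ (m + 1))
      have h3 : b ^ (m + 1) * (L / b ^ (m + 1)) = (L / b ^ (m + 1) * b) * b ^ m := by ring
      omega
    rw [hL', Nat.add_mul_div_right _ _ hB, Nat.add_mul_mod_self_right]
  · rw [Nat.div_eq_of_lt (by omega), Nat.zero_mod]
  · rw [← Nat.add_div_right _ hB]
    congr 2
    omega

lemma sum_Icc_one_eq_sum_range (M : ℕ) (f : ℕ → ℝ) (h : f M = f 0) :
    ∑ k ∈ Icc 1 M, f k = ∑ k ∈ range M, f k := by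
  rw [← sum_range_shift_one M f h, range_eq_Ico, sum_Ico_add' f 0 M 1]
  refine sum_congr ?_ fun _ _ => rfl
  ext k; simp only [mem_Icc, mem_Ico]; omega

lemma sum_phi_eps (hb : 0 < b) (R : ℕ → Equiv.Perm (Fin b)) (σ : Equiv.Perm (Fin b))
    {n j : ℕ} (hj : j < n) :
    ∑ lam ∈ Icc 1 (b ^ n), ∑ N ∈ Icc 1 (b ^ n),
      phi σ (eps b n (fun i => R i) lam N (j + 1)) ((N : ℝ) / (b : ℝ) ^ (j + 1)) *
        phi (pbar σ) (eps b n (fun i => pbar (R i)) lam N (j + 1)) ((N : ℝ) / (b : ℝ) ^ (j + 1))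
      = mixed σ n (n - (j + 1)) := by
  have hb' : (0 : ℝ) < b := by exact_mod_cast hb
  rw [sum_Icc_one_eq_sum_range _ _ (by simp [eps]), ← sum_phi_mul_phi_pbar hb
    (fun l => R (n - 1 - l)) σ (Nat.sub_le n (j + 1)), sum_comm (s := range (b ^ n)) (t := range (b ^ n))]
  refine sum_congr rfl fun L hL => ?_
  have hL' := mem_range.mp hL
  rw [sum_Icc_one_eq_sum_range]
  · refine sum_congr rfl fun N hN => ?_
    have hN' := mem_range.mp hN
    have hs : n - (n - (j + 1)) = j + 1 := by omega
    rw [eps_eq hb R hL' hN' (by omega), show (fun i : Fin n => pbar (R i)) =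
      fun i : Fin n => bar R i from rfl, eps_eq hb (bar R) hL' hN' (by omega), hs,
      show (bar fun l => bar R (n - 1 - l)) = fun l => R (n - 1 - l) from
        bar_bar (fun l => R (n - 1 - l))]
  · have h1 : ((b ^ n : ℕ) : ℝ) / (b : ℝ) ^ (j + 1) = ((b ^ (n - (j + 1)) : ℕ) : ℝ) := by
      obtain ⟨d, rfl⟩ := Nat.exists_eq_add_of_lt hj
      rw [show j + d + 1 - (j + 1) = d by omega]
      push_cast
      field_simp
      ring
    have h2 : ((0 : ℕ) : ℝ) / (b : ℝ) ^ (j + 1) = ((0 : ℕ) : ℝ) := by simp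
    simp only [h1, h2, phi_natCast, zero_mul]

end Eps

section Counting

variable {b : ℕ}

/-- The numerator of the first coordinate of a Hammersley point. -/
def xIdx (R : ℕ → Equiv.Perm (Fin b)) (n : ℕ) (a : Fin n → Fin b) : ℕ :=
  ∑ j : Fin n, (R j (a j) : ℕ) * b ^ (j : ℕ)

/-- The numerator of the second coordinate of a Hammersley point. -/
def yIdx (n : ℕ) (a : Fin n → Fin b) : ℕ := ∑ j : Fin n, (a j : ℕ) * b ^ (n - 1 - (j : ℕ))

/-- The number of Hammersley points in a box with corner at the grid point
`(L / b ^ n, N / b ^ n)`. -/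
def cnt (R : ℕ → Equiv.Perm (Fin b)) (n L N : ℕ) : ℝ :=
  ∑ a : Fin n → Fin b, if xIdx R n a < L ∧ yIdx n a < N then 1 else 0

lemma sum_fin_cons {α : Type*} [AddCommMonoid α] (n : ℕ) (F : (Fin (n + 1) → Fin b) → α) :
    ∑ a, F a = ∑ d : Fin b, ∑ a : Fin n → Fin b, F (Fin.cons d a) := by
  rw [← Fintype.sum_prod_type' (fun (d : Fin b) (a : Fin n → Fin b) => F (Fin.cons d a))]
  exact (Equiv.sum_comp (Fin.consEquiv fun _ => Fin b) F).symm

lemma xIdx_cons (R : ℕ → Equiv.Perm (Fin b)) (n : ℕ) (d : Fin b) (a : Fin n → Fin b) :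
    xIdx R (n + 1) (Fin.cons d a) = R 0 d + b * xIdx (fun l => R (l + 1)) n a := by
  unfold xIdx
  rw [Fin.sum_univ_succ, mul_sum]
  simp only [Fin.val_zero, Fin.cons_zero, pow_zero, mul_one, Fin.cons_succ, Fin.val_succ]
  congr 1
  exact sum_congr rfl fun j _ => by ring

lemma yIdx_cons (n : ℕ) (d : Fin b) (a : Fin n → Fin b) :
    yIdx (n + 1) (Fin.cons d a) = d * b ^ n + yIdx n a := by
  unfold yIdx
  rw [Fin.sum_univ_succ]
  simp only [Fin.val_zero, Fin.cons_zero, Fin.cons_succ, Fin.val_succ]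
  congr 1
  exact sum_congr rfl fun j _ => by congr 2; omega

lemma sum_xIdx {α : Type*} [AddCommMonoid α] (R : ℕ → Equiv.Perm (Fin b)) (n : ℕ) (f : ℕ → α) :
    ∑ a, f (xIdx R n a) = ∑ v ∈ range (b ^ n), f v := by
  induction n generalizing R f with
  | zero => simp [xIdx]
  | succ n ih =>
    rw [sum_fin_cons, pow_succ, sum_range_mul_eq, sum_comm (s := range (b ^ n))]
    simp only [xIdx_cons]
    rw [← Fin.sum_univ_eq_sum_range (fun r => ∑ q ∈ range (b ^ n), f (q * b + r)),
      ← Equiv.sum_comp (R 0) (fun r : Fin b => ∑ q ∈ range (b ^ n), f (q * b + r))]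
    refine sum_congr rfl fun d _ => ?_
    rw [ih (fun l => R (l + 1)) (fun v => f (R 0 d + b * v))]
    exact sum_congr rfl fun v _ => by congr 1; ring

lemma sum_yIdx {α : Type*} [AddCommMonoid α] (n : ℕ) (f : ℕ → α) :
    ∑ a : Fin n → Fin b, f (yIdx n a) = ∑ v ∈ range (b ^ n), f v := by
  induction n generalizing f with
  | zero => simp [yIdx]
  | succ n ih =>
    rw [sum_fin_cons, pow_succ', sum_range_mul_eq]
    simp only [yIdx_cons]
    rw [← Fin.sum_univ_eq_sum_range (fun q => ∑ r ∈ range (b ^ n), f (q * b ^ n + r))]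
    exact sum_congr rfl fun d _ => ih (fun v => f (d * b ^ n + v))

lemma yIdx_lt (n : ℕ) (a : Fin n → Fin b) : yIdx n a < b ^ n := by
  induction n with
  | zero => simp [yIdx]
  | succ n ih =>
    rw [← Fin.cons_self_tail a, yIdx_cons]
    have h1 := ih (Fin.tail a)
    have h2 : ((a 0 : ℕ) + 1) * b ^ n ≤ b * b ^ n := Nat.mul_le_mul_right _ (a 0).isLt
    rw [pow_succ']
    linarith

lemma xIdx_bar_add (R : ℕ → Equiv.Perm (Fin b)) (n : ℕ) (a : Fin n → Fin b) :
    xIdx (bar R) n a + xIdx R n a + 1 = b ^ n := by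
  induction n generalizing R with
  | zero => simp [xIdx]
  | succ n ih =>
    rw [← Fin.cons_self_tail a, xIdx_cons, xIdx_cons]
    have h1 := ih (fun l => R (l + 1)) (Fin.tail a)
    have h2 : (bar R 0 (a 0) : ℕ) + R 0 (a 0) + 1 = b := by
      have := (R 0 (a 0)).isLt
      simp [bar, pbar, tauP, Fin.val_rev]
      omega
    rw [pow_succ', ← h1]
    change (bar R 0 (a 0) : ℕ) + b * xIdx (bar fun l => R (l + 1)) n (Fin.tail a) + _ + 1 = _
    linarith

lemma yIdx_rev_add (n : ℕ) (a : Fin n → Fin b) :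
    yIdx n (fun j => (a j).rev) + yIdx n a + 1 = b ^ n := by
  induction n with
  | zero => simp [yIdx]
  | succ n ih =>
    have h0 : (fun j => (a j).rev) = Fin.cons (a 0).rev (fun j => (Fin.tail a j).rev) := by
      funext j
      refine Fin.cases ?_ (fun j => ?_) j <;> simp [Fin.tail]
    rw [h0, yIdx_cons]
    nth_rw 3 [← Fin.cons_self_tail a]
    rw [yIdx_cons]
    have h1 := ih (Fin.tail a)
    have h2 : ((a 0).rev : ℕ) + a 0 + 1 = b := by
      have := (a 0).isLt
      rw [Fin.val_rev]; omega
    calc _ = (((a 0).rev : ℕ) + a 0) * b ^ n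
        + (yIdx n (fun j => (Fin.tail a j).rev) + yIdx n (Fin.tail a) + 1) := by ring
      _ = (((a 0).rev : ℕ) + a 0 + 1) * b ^ n := by rw [h1]; ring
      _ = _ := by rw [h2, pow_succ']

lemma cnt_succ (hb : 0 < b) (R : ℕ → Equiv.Perm (Fin b)) {n L N : ℕ} (hL : L ≤ b ^ (n + 1))
    (hN : N < b ^ (n + 1)) :
    cnt R (n + 1) L N
      = ∑ d ∈ range (N / b ^ n), (((L + (b - 1 - permVal (R 0) d)) / b : ℕ) : ℝ)
        + cnt (fun l => R (l + 1)) n ((L + (b - 1 - permVal (R 0) (N / b ^ n))) / b)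
            (N % b ^ n) := by
  have hq : N / b ^ n < b := by
    rw [Nat.div_lt_iff_lt_mul (by positivity), ← pow_succ']; exact hN
  have hdm := Nat.div_add_mod N (b ^ n)
  have hr : N % b ^ n < b ^ n := Nat.mod_lt _ (by positivity)
  set q := N / b ^ n
  set r := N % b ^ n
  have hx : ∀ d < b, ∀ X, (permVal (R 0) d + b * X < L
      ↔ X < (L + (b - 1 - permVal (R 0) d)) / b) := by
    intro d _ X
    have := permVal_lt hb (R 0) d
    rw [← Nat.add_one_le_iff (n := X), Nat.le_div_iff_mul_le hb]
    have h1 : (X + 1) * b = b * X + b := by ring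
    rw [h1]; omega
  have hF : ∀ d : Fin b, (∑ a : Fin n → Fin b,
      if xIdx R (n + 1) (Fin.cons d a) < L ∧ yIdx (n + 1) (Fin.cons d a) < N
        then (1:ℝ) else 0) =
      (if (d : ℕ) < q then (((L + (b - 1 - permVal (R 0) d)) / b : ℕ) : ℝ) else 0)
      + (if (d : ℕ) = q then cnt (fun l => R (l + 1)) n ((L + (b - 1 - permVal (R 0) d)) / b) r
          else 0) := by
    intro d
    simp only [xIdx_cons, yIdx_cons, ← permVal_fin, hx d d.isLt]
    rcases lt_trichotomy (d : ℕ) q with h | h | h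
    · rw [if_pos h, if_neg h.ne, add_zero]
      have hy : ∀ a : Fin n → Fin b, (d : ℕ) * b ^ n + yIdx n a < N := by
        intro a
        have h1 := yIdx_lt n a
        have h2 : ((d : ℕ) + 1) * b ^ n ≤ q * b ^ n := Nat.mul_le_mul_right _ h
        linarith
      simp only [hy, and_true]
      rw [sum_xIdx (fun l => R (l + 1)) n (fun v => if v < (L + (b - 1 - permVal (R 0) d)) / b
        then (1:ℝ) else 0), sum_indicator_lt]
      rw [Nat.div_le_iff_le_mul_add_pred hb, ← pow_succ']
      omega
    · rw [if_neg (by omega), if_pos h, zero_add, cnt]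
      have hy : ∀ a : Fin n → Fin b, ((d : ℕ) * b ^ n + yIdx n a < N ↔ yIdx n a < r) := by
        intro a
        rw [h, mul_comm]; omega
      simp only [hy]
    · rw [if_neg (by omega), if_neg (by omega), add_zero]
      refine sum_eq_zero fun a _ => if_neg ?_
      rintro ⟨-, h1⟩
      have h2 : (q + 1) * b ^ n ≤ (d : ℕ) * b ^ n := Nat.mul_le_mul_right _ h
      linarith
  rw [cnt, sum_fin_cons]
  simp only [hF]
  rw [Fin.sum_univ_eq_sum_range (fun d =>
      (if d < q then (((L + (b - 1 - permVal (R 0) d)) / b : ℕ) : ℝ) else 0)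
      + (if d = q then cnt (fun l => R (l + 1)) n ((L + (b - 1 - permVal (R 0) d)) / b) r
          else 0)), sum_add_distrib, sum_ite_eq', if_pos (mem_range.mpr hq), ← sum_filter]
  congr 1
  refine sum_congr ?_ fun _ _ => rfl
  ext d; simp only [mem_filter, mem_range]; omega

lemma term_succ_succ (hb : 0 < b) (R : ℕ → Equiv.Perm (Fin b)) {n i L N : ℕ} (hi : i ≤ n)
    (hN : N < b ^ (n + 1)) :
    term R (n + 1) (i + 1) L N = term (fun l => R (l + 1)) n i
      ((L + (b - 1 - permVal (R 0) (N / b ^ n))) / b) (N % b ^ n) := by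
  have hb' : (0 : ℝ) < b := by exact_mod_cast hb
  have hq : N / b ^ n < b := by
    rw [Nat.div_lt_iff_lt_mul (by positivity), ← pow_succ']; exact hN
  unfold term
  rw [carry_succ_succ _ hi, Nat.mod_eq_of_lt hq, show bar R 0 = pbar (R 0) from rfl,
    permVal_pbar _ hq, show (fun l => bar R (l + 1)) = bar (fun l => R (l + 1)) from rfl,
    ← add_assoc, pow_succ', ← Nat.div_div_eq_div_mul, Nat.add_mul_div_left _ _ hb,
    show n + 1 - (i + 1) = n - i by omega]
  rw [← phi_add_nat _ _ (((N % b ^ n : ℕ) : ℝ) / (b : ℝ) ^ (n - i)) (N / b ^ n * b ^ i)]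
  congr 1
  have hdm : ((b ^ n * (N / b ^ n) + N % b ^ n : ℕ) : ℝ) = N := by rw [Nat.div_add_mod]
  rw [← hdm]
  obtain ⟨d, rfl⟩ := Nat.exists_eq_add_of_le hi
  rw [Nat.add_sub_cancel_left]
  push_cast
  field_simp
  ring

lemma div_add_complement (hb : 0 < b) (p : Equiv.Perm (Fin b)) (L d : ℕ) :
    (L + (b - 1 - permVal p d)) / b = L / b + if permVal p d < L % b then 1 else 0 := by
  have := permVal_lt hb p d
  have h1 := Nat.mod_add_div L b
  have h2 := Nat.mod_lt L hb
  have h3 : L + (b - 1 - permVal p d) = (L % b + (b - 1 - permVal p d)) + b * (L / b) := by omega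
  rw [h3, Nat.add_mul_div_left _ _ hb, add_comm]
  congr 1
  split_ifs with h
  · rw [Nat.div_eq_iff hb]; omega
  · rw [Nat.div_eq_of_lt]; omega

/-- The local discrepancy of a scrambled Hammersley point set at grid points. -/
lemma cnt_eq (hb : 0 < b) (R : ℕ → Equiv.Perm (Fin b)) {n L N : ℕ} (hL : L ≤ b ^ n)
    (hN : N < b ^ n) :
    cnt R n L N = L * N / (b : ℝ) ^ n + ∑ i ∈ range n, term R n i L N := by
  have hb' : (0 : ℝ) < b := by exact_mod_cast hb
  induction n generalizing R L N with
  | zero =>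
    have : N = 0 := by simpa using hN
    simp [cnt, this]
  | succ n ih =>
    rw [cnt_succ hb R hL hN, ih _ _ (Nat.mod_lt _ (by positivity)), sum_range_succ',
      sum_congr rfl fun i hi => term_succ_succ hb R (mem_range.mp hi).le hN]
    · have h0 : term R (n + 1) 0 L N
          = phi (R 0) (L % b) ((N : ℝ) / (b : ℝ) ^ (n + 1)) := by
        simp [term, carry]
      rw [h0, phi_grid hb _ _ hN]
      simp only [div_add_complement hb]
      push_cast
      rw [sum_add_distrib]
      have hdm : (N : ℝ) = (b : ℝ) ^ n * (N / b ^ n : ℕ) + (N % b ^ n : ℕ) := by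
        exact_mod_cast (Nat.div_add_mod N (b ^ n)).symm
      have hdL : (L : ℝ) = (L % b : ℕ) + b * (L / b : ℕ) := by
        exact_mod_cast (Nat.mod_add_div L b).symm
      simp only [sum_const, card_range, nsmul_eq_mul]
      rw [hdm, hdL]
      generalize ((N / b ^ n : ℕ) : ℝ) = u
      generalize ((N % b ^ n : ℕ) : ℝ) = v
      generalize ((L / b : ℕ) : ℝ) = w
      split_ifs <;> (field_simp; ring)
    · have := permVal_lt hb (R 0) (N / b ^ n)
      rw [Nat.div_le_iff_le_mul_add_pred hb, ← pow_succ']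
      omega

lemma cnt_add_cnt_bar (R : ℕ → Equiv.Perm (Fin b)) {n L N : ℕ} (hL : L ≤ b ^ n)
    (hN : N ≤ b ^ n) : cnt R n L N + cnt (bar R) n (b ^ n - L) N = N := by
  rw [← sum_indicator_lt hN, ← sum_yIdx n (fun v => if v < N then (1:ℝ) else 0), cnt, cnt,
    ← sum_add_distrib]
  refine sum_congr rfl fun a _ => ?_
  have := xIdx_bar_add R n a
  have h1 : xIdx (bar R) n a < b ^ n - L ↔ ¬ xIdx R n a < L := by omega
  simp only [h1]
  by_cases h2 : xIdx R n a < L <;> simp [h2]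

lemma cnt_add_cnt_rev (R : ℕ → Equiv.Perm (Fin b)) {n L N : ℕ} (hL : L ≤ b ^ n)
    (hN : N ≤ b ^ n) (hR : ∀ i k, R i (Fin.rev k) = Fin.rev (R i k)) :
    cnt R n L N + cnt (bar R) n L (b ^ n - N) = L := by
  rw [← sum_indicator_lt hL, ← sum_xIdx (bar R) n (fun v => if v < L then (1:ℝ) else 0),
    cnt, cnt, ← Equiv.sum_comp (Equiv.arrowCongr (Equiv.refl (Fin n)) (Fin.revPerm (n := b))),
    ← sum_add_distrib]
  refine sum_congr rfl fun a _ => ?_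
  have hfun : (Equiv.arrowCongr (Equiv.refl (Fin n)) (Fin.revPerm (n := b))) a
      = fun j => (a j).rev := by
    funext j; simp
  have hx : xIdx R n (fun j => (a j).rev) = xIdx (bar R) n a := by
    unfold xIdx
    refine sum_congr rfl fun j _ => ?_
    rw [hR]; simp [bar, pbar, tauP]
  have := yIdx_rev_add n a
  have h1 : yIdx n (fun j => (a j).rev) < N ↔ ¬ yIdx n a < b ^ n - N := by omega
  rw [hfun, hx]
  simp only [h1]
  by_cases h2 : yIdx n a < b ^ n - N <;> simp [h2]

end Counting

section Symmetrized

variable {b : ℕ}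

/-- The local discrepancy of the symmetrized Hammersley point set at the grid point
`(L / b ^ n, N / b ^ n)`. -/
def symDisc (R : ℕ → Equiv.Perm (Fin b)) (n L N : ℕ) : ℝ :=
  cnt R n L N + cnt (bar R) n L N - 2 * L * N / (b : ℝ) ^ n

lemma symDisc_eq_sum_symTerm (hb : 0 < b) (R : ℕ → Equiv.Perm (Fin b)) {n L N : ℕ}
    (hL : L ≤ b ^ n) (hN : N < b ^ n) :
    symDisc R n L N = ∑ i ∈ range n, symTerm R n i L N := by
  simp only [symDisc, symTerm, sum_add_distrib, cnt_eq hb _ hL hN]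
  ring

lemma symDisc_zero_left (R : ℕ → Equiv.Perm (Fin b)) (n N : ℕ) : symDisc R n 0 N = 0 := by
  simp [symDisc, cnt]

lemma symDisc_zero_right (R : ℕ → Equiv.Perm (Fin b)) (n L : ℕ) : symDisc R n L 0 = 0 := by
  simp [symDisc, cnt]

lemma symDisc_reflect_left (hb : 0 < b) (R : ℕ → Equiv.Perm (Fin b)) {n L N : ℕ}
    (hL : L ≤ b ^ n) (hN : N ≤ b ^ n) : symDisc R n (b ^ n - L) N = -symDisc R n L N := by
  have hb' : (0 : ℝ) < b := by exact_mod_cast hb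
  have h1 := cnt_add_cnt_bar R hL hN
  have h2 := cnt_add_cnt_bar (bar R) hL hN
  rw [bar_bar] at h2
  have h3 : 2 * ((b ^ n - L : ℕ) : ℝ) * N / (b : ℝ) ^ n = 2 * N - 2 * L * N / (b : ℝ) ^ n := by
    push_cast [Nat.cast_sub hL]
    field_simp
  simp only [symDisc, h3]
  linarith

lemma symDisc_reflect_right (hb : 0 < b) (R : ℕ → Equiv.Perm (Fin b)) {n L N : ℕ}
    (hL : L ≤ b ^ n) (hN : N ≤ b ^ n) (hR : ∀ i k, R i (Fin.rev k) = Fin.rev (R i k)) :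
    symDisc R n L (b ^ n - N) = -symDisc R n L N := by
  have hb' : (0 : ℝ) < b := by exact_mod_cast hb
  have h1 := cnt_add_cnt_rev R hL hN hR
  have h2 := cnt_add_cnt_rev (bar R) hL hN fun i k => by simp [bar, pbar, tauP, hR]
  rw [bar_bar] at h2
  have h3 : 2 * (L : ℝ) * ((b ^ n - N : ℕ) : ℝ) / (b : ℝ) ^ n
      = 2 * L - 2 * L * N / (b : ℝ) ^ n := by
    push_cast [Nat.cast_sub hN]
    field_simp
  simp only [symDisc, h3]
  linarith

lemma sum_range_shift_eq_zero_of_antisymm {M : ℕ} {g : ℕ → ℝ} (h0 : g 0 = 0)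
    (h : ∀ k ≤ M, g (M - k) = -g k) : ∑ k ∈ range M, g (k + 1) = 0 := by
  have hM : g M = g 0 := by have := h 0 (Nat.zero_le _); simp_all
  have h1 := sum_range_reflect (fun k => g (k + 1)) M
  have h2 : ∑ k ∈ range M, g (M - 1 - k + 1) = -∑ k ∈ range M, g k := by
    rw [← sum_neg_distrib]
    refine sum_congr rfl fun k hk => ?_
    have := mem_range.mp hk
    rw [← h k this.le]; congr 1; omega
  rw [h2, sum_range_shift_one M g hM] at h1
  rw [sum_range_shift_one M g hM]
  linarith

lemma sum_symDisc_mul_eq_zero (hb : 0 < b) (R : ℕ → Equiv.Perm (Fin b)) (n : ℕ)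
    (hR : ∀ i k, R i (Fin.rev k) = Fin.rev (R i k)) :
    ∑ L ∈ range (b ^ n), ∑ N ∈ range (b ^ n),
      symDisc R n (L + 1) (N + 1) * (2 * (L : ℝ) + 2 * N + 3) = 0 := by
  have h1 : ∀ L ∈ range (b ^ n), ∑ N ∈ range (b ^ n), symDisc R n (L + 1) (N + 1) = 0 :=
    fun L hL => sum_range_shift_eq_zero_of_antisymm (g := symDisc R n (L + 1))
      (symDisc_zero_right _ _ _)
      fun k hk => symDisc_reflect_right hb R (Nat.succ_le_of_lt (mem_range.mp hL)) hk hR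
  have h2 : ∀ N ∈ range (b ^ n), ∑ L ∈ range (b ^ n), symDisc R n (L + 1) (N + 1) = 0 :=
    fun N hN => sum_range_shift_eq_zero_of_antisymm (g := fun L => symDisc R n L (N + 1))
      (symDisc_zero_left _ _ _)
      fun k hk => symDisc_reflect_left hb R hk (Nat.succ_le_of_lt (mem_range.mp hN))
  calc _ = ∑ L ∈ range (b ^ n), (2 * (L : ℝ) + 3) * ∑ N ∈ range (b ^ n),
          symDisc R n (L + 1) (N + 1)
        + ∑ N ∈ range (b ^ n), 2 * (N : ℝ) * ∑ L ∈ range (b ^ n),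
          symDisc R n (L + 1) (N + 1) := by
        simp only [mul_sum]
        rw [sum_comm (f := fun N L : ℕ => 2 * (N : ℝ) * symDisc R n (L + 1) (N + 1)),
          ← sum_add_distrib]
        refine sum_congr rfl fun L _ => ?_
        rw [← sum_add_distrib]
        exact sum_congr rfl fun N _ => by ring
    _ = 0 := by
        rw [sum_eq_zero fun L hL => by rw [h1 L hL, mul_zero],
          sum_eq_zero fun N hN => by rw [h2 N hN, mul_zero], add_zero]

lemma sum_symDisc_sq (hb : 0 < b) (R : ℕ → Equiv.Perm (Fin b)) (n : ℕ)
    (hR : ∀ i k, R i (Fin.rev k) = Fin.rev (R i k)) :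
    ∑ L ∈ range (b ^ n), ∑ N ∈ range (b ^ n), symDisc R n (L + 1) (N + 1) ^ 2
      = ∑ N ∈ range (b ^ n), ∑ L ∈ range (b ^ n),
          (∑ i ∈ range n, symTerm R n i L N) ^ 2 := by
  have h1 : ∀ L ≤ b ^ n, symDisc R n L (b ^ n) = 0 := fun L hL => by
    have := symDisc_reflect_right hb R hL (Nat.zero_le _) hR
    simpa [symDisc_zero_right] using this
  have h2 : ∀ N ≤ b ^ n, symDisc R n (b ^ n) N = 0 := fun N hN => by
    have := symDisc_reflect_left hb R (Nat.zero_le _) hN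
    simpa [symDisc_zero_left] using this
  rw [sum_comm, sum_range_shift_one (b ^ n)
    fun N => ∑ L ∈ range (b ^ n), symDisc R n (L + 1) N ^ 2]
  · refine sum_congr rfl fun N hN => ?_
    have hN' := mem_range.mp hN
    rw [sum_range_shift_one (b ^ n) fun L => symDisc R n L N ^ 2]
    · refine sum_congr rfl fun L hL => ?_
      rw [symDisc_eq_sum_symTerm hb R (mem_range.mp hL).le hN']
    · rw [h2 N hN'.le, symDisc_zero_left]
  · refine sum_congr rfl fun L hL => ?_
    rw [h1 _ (Nat.succ_le_of_lt (mem_range.mp hL)), symDisc_zero_right]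

lemma hammPt_eq (hb : 0 < b) (R : ℕ → Equiv.Perm (Fin b)) (n : ℕ) (a : Fin n → Fin b) :
    hammPt b n (fun i => R i) a
      = ((xIdx R n a : ℝ) / ((b ^ n : ℕ) : ℝ), (yIdx n a : ℝ) / ((b ^ n : ℕ) : ℝ)) := by
  have hb' : (0 : ℝ) < b := by exact_mod_cast hb
  unfold hammPt xIdx yIdx
  push_cast
  rw [sum_div, sum_div]
  congr 1
  · refine sum_congr rfl fun j _ => ?_
    obtain ⟨d, hd⟩ := Nat.exists_eq_add_of_lt j.isLt
    rw [show n - (j : ℕ) = d + 1 by omega, show (b : ℝ) ^ n = b ^ (j + (d + 1) : ℕ) by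
      congr 1, pow_add]
    field_simp
    ring
  · refine sum_congr rfl fun j _ => ?_
    obtain ⟨d, hd⟩ := Nat.exists_eq_add_of_lt j.isLt
    rw [show n - 1 - (j : ℕ) = d by omega, show (b : ℝ) ^ n = b ^ (j + 1 + d : ℕ) by
      congr 1; omega, pow_add]
    field_simp
    ring

lemma div_lt_iff_of_mem_cell {M L X : ℕ} (hM : 0 < M) {x : ℝ}
    (hx : x ∈ Set.Ioo ((L : ℝ) / M) (((L + 1 : ℕ) : ℝ) / M)) :
    (X : ℝ) / M < x ↔ X < L + 1 := by
  have hM' : (0 : ℝ) < M := by exact_mod_cast hM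
  constructor
  · intro h
    have := (div_lt_div_iff_of_pos_right hM').mp (h.trans hx.2)
    exact_mod_cast this
  · intro h
    refine lt_of_le_of_lt ?_ hx.1
    rw [div_le_div_iff_of_pos_right hM']
    exact_mod_cast Nat.lt_succ_iff.mp h

lemma localDisc_symFam (hb : 0 < b) (R : ℕ → Equiv.Perm (Fin b)) (n L N : ℕ) {x y : ℝ}
    (hx : x ∈ Set.Ioo ((L : ℝ) / (b ^ n : ℕ)) (((L + 1 : ℕ) : ℝ) / (b ^ n : ℕ)))
    (hy : y ∈ Set.Ioo ((N : ℝ) / (b ^ n : ℕ)) (((N + 1 : ℕ) : ℝ) / (b ^ n : ℕ))) :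
    localDisc (symFam b n fun i => R i) x y
      = cnt R n (L + 1) (N + 1) + cnt (bar R) n (L + 1) (N + 1)
        - 2 * ((b ^ n : ℕ) : ℝ) * x * y := by
  have hM : 0 < b ^ n := by positivity
  have hpt : ∀ (Q : ℕ → Equiv.Perm (Fin b)) (a : Fin n → Fin b),
      (0 ≤ (hammPt b n (fun i => Q i) a).1 ∧ (hammPt b n (fun i => Q i) a).1 < x ∧
        0 ≤ (hammPt b n (fun i => Q i) a).2 ∧ (hammPt b n (fun i => Q i) a).2 < y)
      ↔ xIdx Q n a < L + 1 ∧ yIdx n a < N + 1 := by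
    intro Q a
    rw [hammPt_eq hb]
    simp only [div_lt_iff_of_mem_cell hM hx, div_lt_iff_of_mem_cell hM hy]
    have h1 : (0 : ℝ) ≤ (xIdx Q n a : ℝ) / ((b ^ n : ℕ) : ℝ) := by positivity
    have h2 : (0 : ℝ) ≤ (yIdx n a : ℝ) / ((b ^ n : ℕ) : ℝ) := by positivity
    tauto
  unfold localDisc
  congr 1
  · rw [card_filter]
    push_cast
    rw [Fintype.sum_prod_type, Fintype.sum_bool]
    unfold cnt
    congr 1 <;> refine sum_congr rfl fun a _ => ?_
    · refine if_congr ?_ rfl rfl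
      simpa [symFam] using hpt R a
    · refine if_congr ?_ rfl rfl
      exact hpt (bar R) a
  · simp

/-- The squared `L_2` norm of a function that on each grid cell is a constant minus `2 M x y`. -/
lemma integral_sq_grid {M : ℕ} (hM : 0 < M) (f : ℝ → ℝ → ℝ) (A : ℕ → ℕ → ℝ)
    (hf : ∀ L < M, ∀ N < M, ∀ x ∈ Set.Ioo ((L : ℝ) / M) (((L + 1 : ℕ) : ℝ) / M),
      ∀ y ∈ Set.Ioo ((N : ℝ) / M) (((N + 1 : ℕ) : ℝ) / M), f x y = A L N - 2 * (M : ℝ) * x * y) :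
    ∫ x in (0:ℝ)..1, ∫ y in (0:ℝ)..1, f x y ^ 2
      = ∑ L ∈ range M, ∑ N ∈ range M,
        (A L N ^ 2 / (M : ℝ) ^ 2 - A L N * (2 * L + 1) * (2 * N + 1) / (M : ℝ) ^ 3
          + 4 * (3 * (L : ℝ) ^ 2 + 3 * L + 1) * (3 * (N : ℝ) ^ 2 + 3 * N + 1)
            / (9 * (M : ℝ) ^ 4)) := by
  have hM' : (0 : ℝ) < M := by exact_mod_cast hM
  rw [integral_eq_sum_of_quadratic_on_cells M hM _
    (fun L => ∑ N ∈ range M, A L N ^ 2 / M)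
    (fun L => ∑ N ∈ range M, -(4 * M * A L N * (2 * N + 1) / (2 * (M : ℝ) ^ 2)))
    (fun _ => ∑ N ∈ range M, 4 * (M : ℝ) ^ 2 * (3 * (N : ℝ) ^ 2 + 3 * N + 1)
      / (3 * (M : ℝ) ^ 3))]
  · refine sum_congr rfl fun L _ => ?_
    simp only [sum_div, sum_mul, ← sum_add_distrib]
    refine sum_congr rfl fun N _ => ?_
    field_simp
    ring
  · intro L hL x hx
    rw [integral_eq_sum_of_quadratic_on_cells M hM _ (fun N => A L N ^ 2)
      (fun N => -(4 * M * x * A L N)) (fun _ => 4 * (M : ℝ) ^ 2 * x ^ 2)]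
    · simp only [sum_mul, ← sum_add_distrib]
      refine sum_congr rfl fun N _ => ?_
      field_simp
    · intro N hN y hy
      rw [hf L hL N hN x hx y hy]
      ring

lemma sum_range_grid_polynomial (M : ℕ) :
    ∑ L ∈ range M, ∑ N ∈ range M,
      (4 * ((L : ℝ) + 1) ^ 2 * ((N : ℝ) + 1) ^ 2
        - 2 * ((L : ℝ) + 1) * ((N : ℝ) + 1) * (2 * L + 1) * (2 * N + 1)
        + 4 / 9 * (3 * (L : ℝ) ^ 2 + 3 * L + 1) * (3 * (N : ℝ) ^ 2 + 3 * N + 1))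
      = 25 / 18 * (M : ℝ) ^ 4 + (M : ℝ) ^ 3 + (M : ℝ) ^ 2 / 18 := by
  have h1 : ∀ m : ℕ, ∑ k ∈ range m, ((k : ℝ) + 1) ^ 2
      = (m : ℝ) * (m + 1) * (2 * m + 1) / 6 := by
    intro m
    induction m with
    | zero => simp
    | succ m ih => rw [sum_range_succ, ih]; push_cast; ring
  have h2 : ∀ m : ℕ, ∑ k ∈ range m, ((k : ℝ) + 1) * (2 * (k : ℝ) + 1)
      = (m : ℝ) * (m + 1) * (4 * m - 1) / 6 := by
    intro m
    induction m with
    | zero => simp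
    | succ m ih => rw [sum_range_succ, ih]; push_cast; ring
  have h3 : ∀ m : ℕ, ∑ k ∈ range m, (3 * (k : ℝ) ^ 2 + 3 * k + 1) = (m : ℝ) ^ 3 := by
    intro m
    induction m with
    | zero => simp
    | succ m ih => rw [sum_range_succ, ih]; push_cast; ring
  calc _ = 4 * (∑ k ∈ range M, ((k : ℝ) + 1) ^ 2) * (∑ k ∈ range M, ((k : ℝ) + 1) ^ 2)
      - 2 * (∑ k ∈ range M, ((k : ℝ) + 1) * (2 * k + 1))
        * (∑ k ∈ range M, ((k : ℝ) + 1) * (2 * k + 1))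
      + 4 / 9 * (∑ k ∈ range M, (3 * (k : ℝ) ^ 2 + 3 * k + 1))
        * (∑ k ∈ range M, (3 * (k : ℝ) ^ 2 + 3 * k + 1)) := by
        simp only [mul_assoc, sum_mul_sum]
        simp only [mul_sum, ← sum_sub_distrib, ← sum_add_distrib]
        exact sum_congr rfl fun L _ => sum_congr rfl fun N _ => by ring
    _ = _ := by rw [h1, h2, h3]; ring

lemma integral_localDisc_sq (hb : 0 < b) (R : ℕ → Equiv.Perm (Fin b)) (σ : Equiv.Perm (Fin b))
    (n : ℕ) (hσ : ∀ i, R i = σ ∨ R i = pbar σ)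
    (hR : ∀ i k, R i (Fin.rev k) = Fin.rev (R i k)) :
    ∫ x in (0:ℝ)..1, ∫ y in (0:ℝ)..1, localDisc (symFam b n fun i => R i) x y ^ 2
      = 2 * (n : ℝ) * PhiS2 σ + 13 / 9 + 1 / (b : ℝ) ^ n
        + (2 / (b : ℝ) ^ (2 * n)) * ∑ i ∈ range n, mixed σ n i := by
  have hM : 0 < b ^ n := by positivity
  have hM' : (0 : ℝ) < (b : ℝ) ^ n := by exact_mod_cast hM
  rw [integral_sq_grid hM _ (fun L N => cnt R n (L + 1) (N + 1) + cnt (bar R) n (L + 1) (N + 1))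
    fun L _ N _ x hx y hy => localDisc_symFam hb R n L N hx hy]
  calc _ = (∑ L ∈ range (b ^ n), ∑ N ∈ range (b ^ n), symDisc R n (L + 1) (N + 1) ^ 2)
          / ((b : ℝ) ^ n) ^ 2
        + (∑ L ∈ range (b ^ n), ∑ N ∈ range (b ^ n),
            symDisc R n (L + 1) (N + 1) * (2 * (L : ℝ) + 2 * N + 3)) / ((b : ℝ) ^ n) ^ 3
        + (∑ L ∈ range (b ^ n), ∑ N ∈ range (b ^ n),
            (4 * ((L : ℝ) + 1) ^ 2 * ((N : ℝ) + 1) ^ 2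
              - 2 * ((L : ℝ) + 1) * ((N : ℝ) + 1) * (2 * L + 1) * (2 * N + 1)
              + 4 / 9 * (3 * (L : ℝ) ^ 2 + 3 * L + 1) * (3 * (N : ℝ) ^ 2 + 3 * N + 1)))
          / ((b : ℝ) ^ n) ^ 4 := by
        simp only [sum_div, ← sum_add_distrib]
        refine sum_congr rfl fun L _ => sum_congr rfl fun N _ => ?_
        simp only [symDisc]
        push_cast
        field_simp
        ring
    _ = _ := by
        rw [sum_symDisc_mul_eq_zero hb R n hR, sum_symDisc_sq hb R n hR,
          sum_sq_symTerm_total hb R σ n hσ, sum_range_grid_polynomial]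
        push_cast
        rw [mul_comm 2 n, pow_mul]
        field_simp
        ring

end Symmetrized

theorem stmt16 (b : ℕ) (hb : 2 ≤ b) (n : ℕ) (hn : 1 ≤ n) (σ : Equiv.Perm (Fin b))
    (hcomm : (tauP b).trans σ = σ.trans (tauP b))
    (S : Fin n → Equiv.Perm (Fin b))
    (hS : ∀ i, S i = σ ∨ S i = pbar σ) :
    (2 * (b : ℝ) ^ n * L2disc (symFam b n S)) ^ 2 =
      2 * (n : ℝ) * PhiS2 σ + 13 / 9 + 1 / (b : ℝ) ^ n
        + (2 / (b : ℝ) ^ (2 * n)) *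
            ∑ j : Fin n, ∑ lam ∈ Finset.Icc 1 (b ^ n), ∑ N ∈ Finset.Icc 1 (b ^ n),
              phi σ (eps b n S lam N ((j : ℕ) + 1)) ((N : ℝ) / (b : ℝ) ^ ((j : ℕ) + 1)) *
                phi (pbar σ) (eps b n (fun i => pbar (S i)) lam N ((j : ℕ) + 1))
                  ((N : ℝ) / (b : ℝ) ^ ((j : ℕ) + 1)) := by
  have hb0 : 0 < b := by omega
  obtain ⟨R, rfl, hR⟩ : ∃ R : ℕ → Equiv.Perm (Fin b), S = (fun i : Fin n => R i) ∧
      ∀ i, R i = σ ∨ R i = pbar σ := by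
    refine ⟨fun j => if h : j < n then S ⟨j, h⟩ else σ, ?_, fun i => ?_⟩
    · funext i; simp
    · by_cases h : i < n
      · simpa [h] using hS ⟨i, h⟩
      · simp [h]
  have hσ : ∀ k, σ (Fin.rev k) = Fin.rev (σ k) := fun k => by
    simpa [tauP] using congrArg (fun p : Equiv.Perm (Fin b) => p k) hcomm
  have hrev : ∀ i k, R i (Fin.rev k) = Fin.rev (R i k) := fun i k => by
    rcases hR i with h | h <;> simp [h, pbar, tauP, hσ]
  have hcard : (Fintype.card (Bool × (Fin n → Fin b)) : ℝ) = 2 * (b : ℝ) ^ n := by simp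
  have hpos : (0 : ℝ) < (b : ℝ) ^ n := by positivity
  have hsum : ∑ j : Fin n, ∑ lam ∈ Finset.Icc 1 (b ^ n), ∑ N ∈ Finset.Icc 1 (b ^ n),
      phi σ (eps b n (fun i => R i) lam N ((j : ℕ) + 1)) ((N : ℝ) / (b : ℝ) ^ ((j : ℕ) + 1)) *
        phi (pbar σ) (eps b n (fun i => pbar (R i)) lam N ((j : ℕ) + 1))
          ((N : ℝ) / (b : ℝ) ^ ((j : ℕ) + 1)) = ∑ i ∈ range n, mixed σ n i := by
    rw [sum_congr rfl fun j _ => sum_phi_eps hb0 R σ j.isLt,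
      Fin.sum_univ_eq_sum_range (fun j => mixed σ n (n - (j + 1))),
      ← sum_range_reflect (mixed σ n) n]
    exact sum_congr rfl fun j _ => by congr 1; omega
  rw [hsum, ← integral_localDisc_sq hb0 R σ n hR hrev, L2disc, hcard, ← mul_assoc,
    mul_one_div_cancel (by positivity), one_mul, Real.sq_sqrt]
  exact intervalIntegral.integral_nonneg zero_le_one fun x _ =>
    intervalIntegral.integral_nonneg zero_le_one fun y _ => sq_nonneg _

end SymHamm
end
end

section
/- Let b ≥ 2, n ≥ 1, σ a permutation of {0,…,b−1} and Σ ∈ {σ,σ̄}^n with Σ* = (τ∘σ_0,…,τ∘σ_{n−1}). Then for every 1 ≤ j ≤ n, ∑_{λ=1}^{b^n} ∑_{N=1}^{b^n} φ_{b,ε_j(λ,N,Σ)}^{σ̄}(N/b^j)·φ_{b,ε_j(λ,N,Σ*)}^σ(N/b^j) = ∑_{λ=1}^{b^n} ∑_{N=1}^{b^n} φ_{b,ε_j(λ,N,Σ)}^σ(N/b^j)·φ_{b,ε_j(λ,N,Σ*)}^{σ̄}(N/b^j). -/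
open Finset
open scoped Classical

noncomputable section

namespace SymHamm

/-- `phi` depends on its argument only through the fractional part. -/
lemma phi_congr_fract {b : ℕ} (σ : Equiv.Perm (Fin b)) (h : ℕ) {x y : ℝ}
    (hxy : Int.fract x = Int.fract y) : phi σ h x = phi σ h y := by
  simp only [phi, hxy]

lemma phi_eq_zero_of_fract_eq_zero {b : ℕ} (σ : Equiv.Perm (Fin b)) (h : ℕ) {x : ℝ}
    (hx : Int.fract x = 0) : phi σ h x = 0 := by
  unfold phi
  rw [hx]
  split_ifs with hc
  · simpa [Finset.filter_singleton] using hc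
  · simpa [Finset.filter_singleton] using hc

/-- Conjugate the digits with index at least `j` by the reversal, seen through the
permutations `S i`. -/
def digitReflect {b n : ℕ} (S : Fin n → Equiv.Perm (Fin b)) (j : ℕ) :
    Equiv.Perm (Fin n → Fin b) :=
  Equiv.piCongrRight fun i =>
    if j ≤ (i : ℕ) then ((S i).trans (tauP b)).trans (S i).symm else Equiv.refl _

/-- The natural number below `b ^ n` with the `b`-adic digits `f`. -/
def ofDigitFun {b n : ℕ} (f : Fin n → Fin b) : ℕ := (finFunctionFinEquiv f : ℕ)

lemma ofDigitFun_lt {b n : ℕ} (f : Fin n → Fin b) : ofDigitFun f < b ^ n :=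
  (finFunctionFinEquiv f).isLt

lemma ofDigitFun_digit {b n : ℕ} (f : Fin n → Fin b) (i : Fin n) :
    ofDigitFun f / b ^ (i : ℕ) % b = f i := by
  have h := congrFun (finFunctionFinEquiv.symm_apply_apply f) i
  rw [← congrArg Fin.val h, finFunctionFinEquiv_symm_apply_val]
  rfl

lemma nu_ofDigitFun {b n : ℕ} (S : Fin n → Equiv.Perm (Fin b)) (f : Fin n → Fin b) (j : ℕ) :
    nu b n S (ofDigitFun f) j =
      ∑ i : Fin n, if j ≤ (i : ℕ) then (S i (f i) : ℕ) * b ^ (n - 1 - (i : ℕ)) else 0 := by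
  simp [nu, ofDigitFun_digit, permVal]

lemma nu_digitReflect {b n : ℕ} (S : Fin n → Equiv.Perm (Fin b)) (f : Fin n → Fin b) (j : ℕ) :
    nu b n S (ofDigitFun (digitReflect S j f)) j =
      nu b n (fun i => pbar (S i)) (ofDigitFun f) j := by
  simp only [nu_ofDigitFun]
  refine Finset.sum_congr rfl fun i _ => ?_
  split_ifs with hi <;> simp [digitReflect, pbar, hi]

lemma nu_pbar_digitReflect {b n : ℕ} (S : Fin n → Equiv.Perm (Fin b)) (f : Fin n → Fin b)
    (j : ℕ) :
    nu b n (fun i => pbar (S i)) (ofDigitFun (digitReflect S j f)) j =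
      nu b n S (ofDigitFun f) j := by
  simp only [nu_ofDigitFun]
  refine Finset.sum_congr rfl fun i _ => ?_
  split_ifs with hi <;> simp [digitReflect, pbar, tauP, hi]

lemma eps_congr_nu {b n : ℕ} {S T : Fin n → Equiv.Perm (Fin b)} {M N : ℕ} (lam j : ℕ)
    (hM : M < b ^ n) (hN : N < b ^ n) (h : nu b n S M j = nu b n T N j) :
    eps b n S lam M j = eps b n T lam N j := by
  simp only [eps, h, hM.ne, hN.ne]

lemma ofDigitFun_digitReflect_mod {b n : ℕ} (S : Fin n → Equiv.Perm (Fin b))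
    (f : Fin n → Fin b) (j : ℕ) :
    ofDigitFun (digitReflect S j f) % b ^ j = ofDigitFun f % b ^ j := by
  simp only [ofDigitFun, finFunctionFinEquiv_apply]
  rw [Finset.sum_nat_mod, Finset.sum_nat_mod _ _ fun i => (f i : ℕ) * b ^ (i : ℕ)]
  congr 1
  refine Finset.sum_congr rfl fun i _ => ?_
  by_cases hi : j ≤ (i : ℕ)
  · rw [Nat.mod_eq_zero_of_dvd ((pow_dvd_pow b hi).mul_left _),
      Nat.mod_eq_zero_of_dvd ((pow_dvd_pow b hi).mul_left _)]
  · simp [digitReflect, hi]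

lemma fract_div_pow_eq_of_mod_eq {b j M N : ℕ} (h : M % b ^ j = N % b ^ j) :
    Int.fract ((M : ℝ) / (b : ℝ) ^ j) = Int.fract ((N : ℝ) / (b : ℝ) ^ j) := by
  rw [← Nat.cast_pow, Int.fract_div_natCast_eq_div_natCast_mod,
    Int.fract_div_natCast_eq_div_natCast_mod, h]

lemma sum_Icc_eq_sum_ofDigitFun {b n : ℕ} (F : ℕ → ℝ) (h0 : F 0 = 0) (h1 : F (b ^ n) = 0) :
    ∑ N ∈ Finset.Icc 1 (b ^ n), F N = ∑ f : Fin n → Fin b, F (ofDigitFun f) := by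
  have hIcc : ∑ N ∈ Finset.Icc 1 (b ^ n), F N = ∑ N ∈ Finset.range (b ^ n), F N := by
    have h := Finset.sum_range_succ F (b ^ n)
    rw [Finset.sum_range_succ', h0, h1, add_zero, add_zero] at h
    rw [← h, Finset.range_eq_Ico, Finset.sum_Ico_add' F 0 (b ^ n) 1]
    rfl
  rw [hIcc, Finset.sum_range]
  exact (Equiv.sum_comp finFunctionFinEquiv fun N : Fin (b ^ n) => F N).symm

theorem stmt18 (b : ℕ) (hb : 2 ≤ b) (n : ℕ) (hn : 1 ≤ n) (σ : Equiv.Perm (Fin b))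
    (S : Fin n → Equiv.Perm (Fin b))
    (hS : ∀ i, S i = σ ∨ S i = pbar σ)
    (j : ℕ) (hj1 : 1 ≤ j) (hj2 : j ≤ n) :
    ∑ lam ∈ Finset.Icc 1 (b ^ n), ∑ N ∈ Finset.Icc 1 (b ^ n),
        phi (pbar σ) (eps b n S lam N j) ((N : ℝ) / (b : ℝ) ^ j) *
          phi σ (eps b n (fun i => pbar (S i)) lam N j) ((N : ℝ) / (b : ℝ) ^ j) =
      ∑ lam ∈ Finset.Icc 1 (b ^ n), ∑ N ∈ Finset.Icc 1 (b ^ n),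
        phi σ (eps b n S lam N j) ((N : ℝ) / (b : ℝ) ^ j) *
          phi (pbar σ) (eps b n (fun i => pbar (S i)) lam N j)
            ((N : ℝ) / (b : ℝ) ^ j) := by
  refine Finset.sum_congr rfl fun lam _ => ?_
  have fract_zero : Int.fract (((0 : ℕ) : ℝ) / (b : ℝ) ^ j) = 0 := by simp
  have fract_top : Int.fract (((b ^ n : ℕ) : ℝ) / (b : ℝ) ^ j) = 0 := by
    rw [← fract_zero]
    exact fract_div_pow_eq_of_mod_eq (by
      rw [Nat.mod_eq_zero_of_dvd (pow_dvd_pow b hj2), Nat.zero_mod])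
  rw [sum_Icc_eq_sum_ofDigitFun, sum_Icc_eq_sum_ofDigitFun, ← Equiv.sum_comp (digitReflect S j)]
  · refine Finset.sum_congr rfl fun f _ => ?_
    have hx := fract_div_pow_eq_of_mod_eq (ofDigitFun_digitReflect_mod S f j)
    rw [phi_congr_fract _ _ hx, phi_congr_fract _ _ hx,
      eps_congr_nu lam j (ofDigitFun_lt _) (ofDigitFun_lt f) (nu_digitReflect S f j),
      eps_congr_nu lam j (ofDigitFun_lt _) (ofDigitFun_lt f) (nu_pbar_digitReflect S f j),
      mul_comm]
  all_goals
    rw [phi_eq_zero_of_fract_eq_zero _ _ (by first | exact fract_zero | exact fract_top), zero_mul]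

end SymHamm
end
end
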